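/- For every cartesian operad V, the cartesian substitution construction CSUB[V] — with the same composition, whiskering and symmetries as the substitution construction, and with copy and discard given by the singleton renaming words [Δₙ] and [!ₙ] — is a cartesian PROP (in particular, every morphism of CSUB[V] is central). -/

import Mathlib

universe u

/-- A renaming from `m` to `n` is a function `Fin m → Fin n`. -/
abbrev Ren (m n : ℕ) : Type := Fin m → Fin n

/-- The identity renaming. -/
def idRen (n : ℕ) : Ren n n := fun i => i

/-- Block sum of renamings. -/
def bsum {m₁ n₁ m₂ n₂ : ℕ} (r : Ren m₁ n₁) (r' : Ren m₂ n₂) : Ren (m₁ + m₂) (n₁ + n₂) :=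
  fun i => Fin.addCases (motive := fun _ => Fin (n₁ + n₂))
    (fun a => Fin.castAdd n₂ (r a)) (fun b => Fin.natAdd n₁ (r' b)) i

/-- The block swap `σ_{m,n} : m+n → n+m`. -/
def swapRen (m n : ℕ) : Ren (m + n) (n + m) :=
  fun i => Fin.addCases (motive := fun _ => Fin (n + m))
    (fun a => Fin.natAdd n a) (fun b => Fin.castAdd m b) i

/-- The copy renaming `Δ_n : n+n → n`, sending both copies of `i` to `i`. -/
def copyRen (n : ℕ) : Ren (n + n) n :=
  fun i => Fin.addCases (motive := fun _ => Fin n) (fun a => a) (fun b => b) i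

/-- The discard renaming `!_n : 0 → n` (the empty function). -/
def discardRen (n : ℕ) : Ren 0 n := fun i => i.elim0

/-- Cast along an equality of arities. -/
def acast {C : ℕ → Type u} {m n : ℕ} (h : m = n) : C m → C n := fun x => h ▸ x

/-- Cast along equalities of both arities. -/
def hcast {H : ℕ → ℕ → Type u} {a a' b b' : ℕ} (h₁ : a = a') (h₂ : b = b') : H a b → H a' b' :=
  fun f => h₂ ▸ h₁ ▸ f

/-- A preoperad: a family of sets `C n` with an identity `one ∈ C 1` and single
substitution `f{n₁ ⊣ g ⊢ n₂}`, satisfying unit and associativity laws. -/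
structure Preoperad where
  C : ℕ → Type
  one : C 1
  subst : ∀ (n₁ n₂ : ℕ) {m : ℕ}, C (n₁ + 1 + n₂) → C m → C (n₁ + m + n₂)
  left_unit : ∀ {m : ℕ} (g : C m), subst 0 0 one g = acast (C := C) (by omega) g
  right_unit : ∀ {n₁ n₂ : ℕ} (f : C (n₁ + 1 + n₂)), subst n₁ n₂ f one = f
  assoc : ∀ {m₁ m₂ n₁ n₂ k : ℕ} (f : C (m₁ + 1 + m₂)) (g : C (n₁ + 1 + n₂)) (h : C k),
    subst (m₁ + n₁) (n₂ + m₂) (acast (C := C) (by omega) (subst m₁ m₂ f g)) h =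
      acast (C := C) (by omega) (subst m₁ m₂ f (subst n₁ n₂ g h))

/-- Two elements `g₁ ∈ C k₁`, `g₂ ∈ C k₂` of a preoperad commute when substituting them
into the two distinguished inputs of any morphism in either order yields the same
result (in both orientations). -/
def Preoperad.Commute (P : Preoperad) {k₁ k₂ : ℕ} (g₁ : P.C k₁) (g₂ : P.C k₂) : Prop :=
  ∀ (m₁ m m₂ : ℕ) (f : P.C (m₁ + 1 + m + 1 + m₂)),
    (P.subst (m₁ + k₁ + m) m₂
        (acast (C := P.C) (by omega)
          (P.subst m₁ (m + 1 + m₂) (acast (C := P.C) (by omega) f) g₁)) g₂ =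
      acast (C := P.C) (by omega)
        (P.subst m₁ (m + k₂ + m₂)
          (acast (C := P.C) (by omega) (P.subst (m₁ + 1 + m) m₂ f g₂)) g₁)) ∧
    (P.subst (m₁ + k₂ + m) m₂
        (acast (C := P.C) (by omega)
          (P.subst m₁ (m + 1 + m₂) (acast (C := P.C) (by omega) f) g₂)) g₁ =
      acast (C := P.C) (by omega)
        (P.subst m₁ (m + k₁ + m₂)
          (acast (C := P.C) (by omega) (P.subst (m₁ + 1 + m) m₂ f g₁)) g₂))

/-- An element is central if it commutes with every element. -/
def Preoperad.Central (P : Preoperad) {k : ℕ} (g : P.C k) : Prop :=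
  ∀ {k' : ℕ} (g' : P.C k'), P.Commute g g'

/-- A `Ren`-cartesian preoperad: a preoperad equipped with reindexing `f[r]` along all
renamings, functorially, and satisfying the renaming–substitution interchange law. -/
structure RenPreoperad extends Preoperad where
  ren : ∀ {m n : ℕ}, C m → Ren m n → C n
  ren_id : ∀ {m : ℕ} (f : C m), ren f (idRen m) = f
  ren_comp : ∀ {m n k : ℕ} (f : C m) (r₁ : Ren m n) (r₂ : Ren n k),
    ren f (r₂ ∘ r₁) = ren (ren f r₁) r₂
  ren_subst : ∀ {n₁ n₂ k m₁ m₂ m : ℕ} (f : C (n₁ + 1 + n₂)) (g : C k)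
      (r₁ : Ren n₁ m₁) (r : Ren k m) (r₂ : Ren n₂ m₂),
    ren (subst n₁ n₂ f g) (bsum (bsum r₁ r) r₂) =
      subst m₁ m₂ (ren f (bsum (bsum r₁ (idRen 1)) r₂)) (ren g r)

/-- A symmetric `Ren`-cartesian preoperad: transpositions are natural with respect to
single substitution, in both orientations. -/
structure SymRenPreoperad extends RenPreoperad where
  sym_nat₁ : ∀ {m₁ m₂ n : ℕ} (f : C (m₁ + 2 + m₂)) (g : C n),
    subst m₁ (1 + m₂)
        (acast (C := C) (by omega)
          (ren f (bsum (bsum (idRen m₁) (swapRen 1 1)) (idRen m₂)))) g =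
      acast (C := C) (by omega)
        (ren (acast (C := C) (by omega) (subst (m₁ + 1) m₂ f g))
          (bsum (bsum (idRen m₁) (swapRen 1 n)) (idRen m₂)))
  sym_nat₂ : ∀ {m₁ m₂ n : ℕ} (f : C (m₁ + 2 + m₂)) (g : C n),
    subst (m₁ + 1) m₂
        (ren f ((bsum (bsum (idRen m₁) (swapRen 1 1)) (idRen m₂) :
          Ren (m₁ + (1 + 1) + m₂) (m₁ + (1 + 1) + m₂)))) g =
      acast (C := C) (by omega)
        (ren (acast (C := C) (by omega) (subst m₁ (1 + m₂) (acast (C := C) (by omega) f) g))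
          (bsum (bsum (idRen m₁) (swapRen n 1)) (idRen m₂)))

/-- A cartesian operad: a `Ren`-cartesian symmetric preoperad in which every element is
central and in which discard and copy are natural with respect to single substitution. -/
structure CartOperad extends SymRenPreoperad where
  central : ∀ {k : ℕ} (g : C k), toPreoperad.Central g
  discard_nat : ∀ {m₁ m₂ n : ℕ} (f : C (m₁ + 0 + m₂)) (g : C n),
    subst m₁ m₂
        (ren f ((bsum (bsum (idRen m₁) (discardRen 1)) (idRen m₂) :
          Ren (m₁ + 0 + m₂) (m₁ + 1 + m₂)))) g =
      ren f ((bsum (bsum (idRen m₁) (discardRen n)) (idRen m₂) :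
        Ren (m₁ + 0 + m₂) (m₁ + n + m₂)))
  copy_nat : ∀ {m₁ m₂ n : ℕ} (f : C (m₁ + 2 + m₂)) (g : C n),
    subst m₁ m₂
        (ren f ((bsum (bsum (idRen m₁) (copyRen 1)) (idRen m₂) :
          Ren (m₁ + (1 + 1) + m₂) (m₁ + 1 + m₂)))) g =
      ren (acast (C := C) (by omega)
            (subst m₁ (n + m₂) (acast (C := C) (by omega) (subst (m₁ + 1) m₂ f g)) g))
        ((bsum (bsum (idRen m₁) (copyRen n)) (idRen m₂) :
          Ren (m₁ + (n + n) + m₂) (m₁ + n + m₂)))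

/-- A cartesian preoperad functor: preserves the identity, single substitution and
reindexing. -/
structure RenPreoperadHom (P Q : RenPreoperad) where
  map : ∀ {n : ℕ}, P.C n → Q.C n
  map_one : map P.one = Q.one
  map_subst : ∀ {n₁ n₂ m : ℕ} (f : P.C (n₁ + 1 + n₂)) (g : P.C m),
    map (P.subst n₁ n₂ f g) = Q.subst n₁ n₂ (map f) (map g)
  map_ren : ∀ {m n : ℕ} (f : P.C m) (r : Ren m n), map (P.ren f r) = Q.ren (map f) r

/-- Composition of cartesian preoperad functors. -/
def RenPreoperadHom.comp {P Q R : RenPreoperad} (F : RenPreoperadHom P Q)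
    (G : RenPreoperadHom Q R) : RenPreoperadHom P R where
  map f := G.map (F.map f)
  map_one := by show G.map (F.map P.one) = _; rw [F.map_one, G.map_one]
  map_subst f g := by
    show G.map (F.map _) = _
    rw [F.map_subst, G.map_subst]
  map_ren f r := by
    show G.map (F.map _) = _
    rw [F.map_ren, G.map_ren]

/-- A Freyd operad: a cartesian operad `V` of values, a symmetric `Ren`-cartesian
preoperad `C` of computations, and a cartesian preoperad functor `I : V → C` whose image
consists of central elements (and hence forms a cartesian operad). -/
structure FreydOperad where
  V : CartOperad
  C : SymRenPreoperad
  I : RenPreoperadHom V.toRenPreoperad C.toRenPreoperad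
  I_central : ∀ {n : ℕ} (v : V.C n), C.toPreoperad.Central (I.map v)

/-- A Freyd operad functor: a pair of cartesian preoperad functors commuting with the
functors `I`. -/
structure FreydOperadHom (O₁ O₂ : FreydOperad) where
  mapV : RenPreoperadHom O₁.V.toRenPreoperad O₂.V.toRenPreoperad
  mapC : RenPreoperadHom O₁.C.toRenPreoperad O₂.C.toRenPreoperad
  square : ∀ {n : ℕ} (v : O₁.V.C n), mapC.map (O₁.I.map v) = O₂.I.map (mapV.map v)

/-- Composition of Freyd operad functors. -/
def FreydOperadHom.comp {O₁ O₂ O₃ : FreydOperad} (F : FreydOperadHom O₁ O₂)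
    (G : FreydOperadHom O₂ O₃) : FreydOperadHom O₁ O₃ where
  mapV := F.mapV.comp G.mapV
  mapC := F.mapC.comp G.mapC
  square v := by
    show G.mapC.map (F.mapC.map _) = _
    rw [F.square, G.square]; rfl

/-- A weakly closed Freyd operad: abstraction `λₙ : C(n+1) → V(n)` and application
`@ ∈ C 2` satisfying the β-law and compatibility of abstraction with substitution. -/
structure WCFreydOperad extends FreydOperad where
  abs : ∀ {n : ℕ}, C.C (n + 1) → V.C n
  app : C.C 2
  beta : ∀ {n : ℕ} (f : C.C (n + 1)),
    C.subst 0 1 app (I.map (abs f)) = acast (C := C.C) (by omega) f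
  abs_subst : ∀ {m₁ m₂ k : ℕ} (f : C.C (m₁ + 1 + (m₂ + 1))) (v : V.C k),
    abs (acast (C := C.C) (by omega) (C.subst m₁ (m₂ + 1) f (I.map v))) =
      V.subst m₁ m₂ (abs (acast (C := C.C) (by omega) f)) v

/-- Pre-substitutions over a family of carriers `C`: finite words of single
substitutions `⟨m₁ ⊣ g ⊢ m₂⟩` and renamings (read contravariantly), with matching
arities.  A term `s : PreSub C m n` is a word from `m` to `n`; the head of the word is
the step applied first to an element of `C n`. -/
inductive PreSub (C : ℕ → Type) : ℕ → ℕ → Type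
  | nil {n : ℕ} : PreSub C n n
  | subCons {m : ℕ} (m₁ m₂ : ℕ) {k : ℕ} (g : C k) (rest : PreSub C m (m₁ + k + m₂)) :
      PreSub C m (m₁ + 1 + m₂)
  | renCons {m a b : ℕ} (r : Ren a b) (rest : PreSub C m b) : PreSub C m a

namespace PreSub

variable {C : ℕ → Type}

/-- Cast a pre-substitution along an equality of its upper arity. -/
def castU {m n n' : ℕ} (h : n = n') (s : PreSub C m n) : PreSub C m n' := h ▸ s

/-- Concatenation (composition) of pre-substitutions. -/
def append : ∀ {m k n : ℕ}, PreSub C k n → PreSub C m k → PreSub C m n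
  | _, _, _, .nil, t => t
  | _, _, _, .subCons m₁ m₂ g rest, t => .subCons m₁ m₂ g (rest.append t)
  | _, _, _, .renCons r rest, t => .renCons r (rest.append t)

/-- Left whiskering of a pre-substitution, padding each step by `l` unused variables on
the left. -/
def whiskL (l : ℕ) : ∀ {m n : ℕ}, PreSub C m n → PreSub C (l + m) (l + n)
  | _, _, .nil => .nil
  | _, _, .subCons m₁ m₂ g rest =>
      castU (by omega) (.subCons (l + m₁) m₂ g (castU (by omega) (whiskL l rest)))
  | _, _, .renCons r rest => .renCons (bsum (idRen l) r) (whiskL l rest)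

/-- Right whiskering of a pre-substitution, padding each step by `l` unused variables on
the right. -/
def whiskR (l : ℕ) : ∀ {m n : ℕ}, PreSub C m n → PreSub C (m + l) (n + l)
  | _, _, .nil => .nil
  | _, _, .subCons m₁ m₂ g rest =>
      castU (by omega) (.subCons m₁ (m₂ + l) g (castU (by omega) (whiskR l rest)))
  | _, _, .renCons r rest => .renCons (bsum r (idRen l)) (whiskR l rest)

/-- Apply `F` to every substitution step of a word, leaving renaming steps unchanged. -/
def mapWord {C₁ C₂ : ℕ → Type} (F : ∀ {k : ℕ}, C₁ k → C₂ k) :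
    ∀ {m n : ℕ}, PreSub C₁ m n → PreSub C₂ m n
  | _, _, .nil => .nil
  | _, _, .subCons m₁ m₂ g rest => .subCons m₁ m₂ (F g) (mapWord F rest)
  | _, _, .renCons r rest => .renCons r (mapWord F rest)

/-- The singleton word `[⟨0 ⊣ g ⊢ 0⟩] : n → 1` associated to `g ∈ C n`. -/
def sing {n : ℕ} (g : C n) : PreSub C n 1 :=
  .subCons 0 0 g (castU (by omega) .nil)

end PreSub

/-- Application `f ⋆ s` of a pre-substitution `s : m → n` to `f ∈ C n`, yielding an
element of `C m`: substitution steps act by single substitution and renaming steps by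
reindexing, in the order of the word. -/
def PreSub.apply (P : RenPreoperad) : ∀ {m n : ℕ}, PreSub P.C m n → P.C n → P.C m
  | _, _, .nil, f => f
  | _, _, .subCons m₁ m₂ g rest, f => PreSub.apply P rest (P.subst m₁ m₂ f g)
  | _, _, .renCons r rest, f => PreSub.apply P rest (P.ren f r)

/-- The congruence on pre-substitutions generated by the symmetric rules of the
substitution construction (rules apply in arbitrary word contexts). -/
inductive SubEquiv (P : SymRenPreoperad) : {m n : ℕ} → PreSub P.C m n → PreSub P.C m n → Prop
  | refl {m n : ℕ} (s : PreSub P.C m n) : SubEquiv P s s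
  | symm {m n : ℕ} {s t : PreSub P.C m n} : SubEquiv P s t → SubEquiv P t s
  | trans {m n : ℕ} {s t u : PreSub P.C m n} :
      SubEquiv P s t → SubEquiv P t u → SubEquiv P s u
  | congrSub {m m₁ m₂ k : ℕ} (g : P.C k) {s t : PreSub P.C m (m₁ + k + m₂)} :
      SubEquiv P s t → SubEquiv P (.subCons m₁ m₂ g s) (.subCons m₁ m₂ g t)
  | congrRen {m a b : ℕ} (r : Ren a b) {s t : PreSub P.C m b} :
      SubEquiv P s t → SubEquiv P (.renCons r s) (.renCons r t)
  /-- (U₁) identity substitution steps are deleted -/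
  | unit₁ {m m₁ m₂ : ℕ} (s : PreSub P.C m (m₁ + 1 + m₂)) :
      SubEquiv P (.subCons m₁ m₂ P.one s) s
  /-- (U₂) identity renaming steps are deleted -/
  | unit₂ {m n : ℕ} (s : PreSub P.C m n) : SubEquiv P (.renCons (idRen n) s) s
  /-- (A) adjacent compatible substitution steps merge by operadic composition -/
  | merge {m m₁ m₂ n₁ n₂ k : ℕ} (g : P.C (n₁ + 1 + n₂)) (h : P.C k)
      (rest : PreSub P.C m (m₁ + n₁ + k + (n₂ + m₂))) :
      SubEquiv P
        (.subCons m₁ m₂ g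
          (PreSub.castU (by omega) (.subCons (m₁ + n₁) (n₂ + m₂) h rest)))
        (.subCons m₁ m₂ (P.subst n₁ n₂ g h) (PreSub.castU (by omega) rest))
  /-- (R) adjacent renaming steps compose -/
  | renComp {m a b c : ℕ} (r₁ : Ren a b) (r₂ : Ren b c) (rest : PreSub P.C m c) :
      SubEquiv P (.renCons r₁ (.renCons r₂ rest)) (.renCons (r₂ ∘ r₁) rest)
  /-- (N) a substitution step followed by a compatible renaming equals the reindexed
  substitution preceded by a renaming -/
  | interchange {m n₁ n₂ k a b c : ℕ} (v : P.C k)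
      (ρ₁ : Ren n₁ a) (ρ : Ren k b) (ρ₂ : Ren n₂ c)
      (rest : PreSub P.C m (a + b + c)) :
      SubEquiv P
        (.subCons n₁ n₂ v (.renCons (bsum (bsum ρ₁ ρ) ρ₂) rest))
        (.renCons (bsum (bsum ρ₁ (idRen 1)) ρ₂) (.subCons a c (P.ren v ρ) rest))
  /-- (S_ℓ) transposition renamings commute with substitution steps -/
  | symL {m m₁ m₂ n : ℕ} (g : P.C n) (rest : PreSub P.C m (m₁ + n + (1 + m₂))) :
      SubEquiv P
        (.renCons (bsum (bsum (idRen m₁) (swapRen 1 1)) (idRen m₂))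
          (PreSub.castU (by omega) (.subCons m₁ (1 + m₂) g rest)))
        (.subCons (m₁ + 1) m₂ g
          (PreSub.castU (by omega)
            (.renCons (bsum (bsum (idRen m₁) (swapRen 1 n)) (idRen m₂))
              (PreSub.castU (by omega) rest))))
  /-- (S_r) transposition renamings commute with substitution steps -/
  | symR {m m₁ m₂ n : ℕ} (g : P.C n) (rest : PreSub P.C m (m₁ + 1 + n + m₂)) :
      SubEquiv P
        (.renCons (bsum (bsum (idRen m₁) (swapRen 1 1)) (idRen m₂))
          (.subCons (m₁ + 1) m₂ g (PreSub.castU (by omega) rest)))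
        (PreSub.castU (by omega)
          (.subCons m₁ (1 + m₂) g
            (PreSub.castU (by omega)
              (.renCons (bsum (bsum (idRen m₁) (swapRen n 1)) (idRen m₂))
                (PreSub.castU (by omega) rest)))))

/-- The congruence on pre-substitutions generated by the symmetric rules together with
the cartesian rules (centrality of substitution steps, naturality of discard and copy). -/
inductive CSubEquiv (V : CartOperad) : {m n : ℕ} → PreSub V.C m n → PreSub V.C m n → Prop
  | refl {m n : ℕ} (s : PreSub V.C m n) : CSubEquiv V s s
  | symm {m n : ℕ} {s t : PreSub V.C m n} : CSubEquiv V s t → CSubEquiv V t s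
  | trans {m n : ℕ} {s t u : PreSub V.C m n} :
      CSubEquiv V s t → CSubEquiv V t u → CSubEquiv V s u
  | congrSub {m m₁ m₂ k : ℕ} (g : V.C k) {s t : PreSub V.C m (m₁ + k + m₂)} :
      CSubEquiv V s t → CSubEquiv V (.subCons m₁ m₂ g s) (.subCons m₁ m₂ g t)
  | congrRen {m a b : ℕ} (r : Ren a b) {s t : PreSub V.C m b} :
      CSubEquiv V s t → CSubEquiv V (.renCons r s) (.renCons r t)
  | unit₁ {m m₁ m₂ : ℕ} (s : PreSub V.C m (m₁ + 1 + m₂)) :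
      CSubEquiv V (.subCons m₁ m₂ V.one s) s
  | unit₂ {m n : ℕ} (s : PreSub V.C m n) : CSubEquiv V (.renCons (idRen n) s) s
  | merge {m m₁ m₂ n₁ n₂ k : ℕ} (g : V.C (n₁ + 1 + n₂)) (h : V.C k)
      (rest : PreSub V.C m (m₁ + n₁ + k + (n₂ + m₂))) :
      CSubEquiv V
        (.subCons m₁ m₂ g
          (PreSub.castU (by omega) (.subCons (m₁ + n₁) (n₂ + m₂) h rest)))
        (.subCons m₁ m₂ (V.subst n₁ n₂ g h) (PreSub.castU (by omega) rest))
  | renComp {m a b c : ℕ} (r₁ : Ren a b) (r₂ : Ren b c) (rest : PreSub V.C m c) :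
      CSubEquiv V (.renCons r₁ (.renCons r₂ rest)) (.renCons (r₂ ∘ r₁) rest)
  | interchange {m n₁ n₂ k a b c : ℕ} (v : V.C k)
      (ρ₁ : Ren n₁ a) (ρ : Ren k b) (ρ₂ : Ren n₂ c)
      (rest : PreSub V.C m (a + b + c)) :
      CSubEquiv V
        (.subCons n₁ n₂ v (.renCons (bsum (bsum ρ₁ ρ) ρ₂) rest))
        (.renCons (bsum (bsum ρ₁ (idRen 1)) ρ₂) (.subCons a c (V.ren v ρ) rest))
  | symL {m m₁ m₂ n : ℕ} (g : V.C n) (rest : PreSub V.C m (m₁ + n + (1 + m₂))) :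
      CSubEquiv V
        (.renCons (bsum (bsum (idRen m₁) (swapRen 1 1)) (idRen m₂))
          (PreSub.castU (by omega) (.subCons m₁ (1 + m₂) g rest)))
        (.subCons (m₁ + 1) m₂ g
          (PreSub.castU (by omega)
            (.renCons (bsum (bsum (idRen m₁) (swapRen 1 n)) (idRen m₂))
              (PreSub.castU (by omega) rest))))
  | symR {m m₁ m₂ n : ℕ} (g : V.C n) (rest : PreSub V.C m (m₁ + 1 + n + m₂)) :
      CSubEquiv V
        (.renCons (bsum (bsum (idRen m₁) (swapRen 1 1)) (idRen m₂))
          (.subCons (m₁ + 1) m₂ g (PreSub.castU (by omega) rest)))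
        (PreSub.castU (by omega)
          (.subCons m₁ (1 + m₂) g
            (PreSub.castU (by omega)
              (.renCons (bsum (bsum (idRen m₁) (swapRen n 1)) (idRen m₂))
                (PreSub.castU (by omega) rest)))))
  /-- (CEN) adjacent independent substitution steps commute -/
  | cen {m' m₁ m m₂ n₁ n₂ : ℕ} (g₁ : V.C n₁) (g₂ : V.C n₂)
      (rest : PreSub V.C m' (m₁ + n₁ + m + n₂ + m₂)) :
      CSubEquiv V
        (.subCons m₁ (m + 1 + m₂) g₁
          (PreSub.castU (by omega) (.subCons (m₁ + n₁ + m) m₂ g₂ rest)))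
        (PreSub.castU (by omega)
          (.subCons (m₁ + 1 + m) m₂ g₂
            (PreSub.castU (by omega)
              (.subCons m₁ (m + n₂ + m₂) g₁ (PreSub.castU (by omega) rest)))))
  /-- (D) a discard renaming followed by a substitution step equals a discard renaming -/
  | dis {m m₁ m₂ n : ℕ} (g : V.C n) (rest : PreSub V.C m (m₁ + n + m₂)) :
      CSubEquiv V
        (.renCons (bsum (bsum (idRen m₁) (discardRen 1)) (idRen m₂) :
            Ren (m₁ + 0 + m₂) (m₁ + 1 + m₂))
          (.subCons m₁ m₂ g rest))
        (.renCons (bsum (bsum (idRen m₁) (discardRen n)) (idRen m₂) :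
            Ren (m₁ + 0 + m₂) (m₁ + n + m₂))
          rest)
  /-- (C) a copy renaming followed by a substitution step equals a doubled substitution
  step followed by a copy renaming -/
  | cop {m m₁ m₂ n : ℕ} (g : V.C n) (rest : PreSub V.C m (m₁ + n + m₂)) :
      CSubEquiv V
        (.renCons (bsum (bsum (idRen m₁) (copyRen 1)) (idRen m₂) :
            Ren (m₁ + (1 + 1) + m₂) (m₁ + 1 + m₂))
          (.subCons m₁ m₂ g rest))
        (.subCons (m₁ + 1) m₂ g
          (PreSub.castU (by omega)
            (.subCons m₁ (n + m₂) g
              (PreSub.castU (by omega)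
                (.renCons (bsum (bsum (idRen m₁) (copyRen n)) (idRen m₂) :
                    Ren (m₁ + (n + n) + m₂) (m₁ + n + m₂))
                  rest)))))

/-- Morphisms of the substitution category `SUB[C]`: pre-substitutions modulo the
symmetric rules. -/
abbrev SUBQ (P : SymRenPreoperad) (m n : ℕ) : Type := Quot (@SubEquiv P m n)

/-- Morphisms of the cartesian substitution category `CSUB[V]`: pre-substitutions modulo
the symmetric rules together with the cartesian rules. -/
abbrev CSUBQ (V : CartOperad) (m n : ℕ) : Type := Quot (@CSubEquiv V m n)

/-- A pre-PROP structure on a hom-family `H`: a strict symmetric premonoidal category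
with objects `ℕ` and tensor given by addition, presented by composition, identities,
whiskering functors `k ⋊ (−)`, `(−) ⋉ k` and coherent natural symmetries. -/
structure PrePROPOn (H : ℕ → ℕ → Type) where
  id : ∀ n : ℕ, H n n
  comp : ∀ {a b c : ℕ}, H a b → H b c → H a c
  comp_id : ∀ {a b : ℕ} (f : H a b), comp f (id b) = f
  id_comp : ∀ {a b : ℕ} (f : H a b), comp (id a) f = f
  comp_assoc : ∀ {a b c d : ℕ} (f : H a b) (g : H b c) (h : H c d),
    comp (comp f g) h = comp f (comp g h)
  whiskL : ∀ (k : ℕ) {m n : ℕ}, H m n → H (k + m) (k + n)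
  whiskR : ∀ (k : ℕ) {m n : ℕ}, H m n → H (m + k) (n + k)
  whiskL_id : ∀ (k n : ℕ), whiskL k (id n) = id (k + n)
  whiskR_id : ∀ (k n : ℕ), whiskR k (id n) = id (n + k)
  whiskL_comp : ∀ (k : ℕ) {a b c : ℕ} (f : H a b) (g : H b c),
    whiskL k (comp f g) = comp (whiskL k f) (whiskL k g)
  whiskR_comp : ∀ (k : ℕ) {a b c : ℕ} (f : H a b) (g : H b c),
    whiskR k (comp f g) = comp (whiskR k f) (whiskR k g)
  whiskL_zero : ∀ {m n : ℕ} (f : H m n),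
    whiskL 0 f = hcast (H := H) (by omega) (by omega) f
  whiskR_zero : ∀ {m n : ℕ} (f : H m n), whiskR 0 f = f
  whiskL_add : ∀ (k l : ℕ) {m n : ℕ} (f : H m n),
    whiskL k (whiskL l f) = hcast (H := H) (by omega) (by omega) (whiskL (k + l) f)
  whiskR_add : ∀ (k l : ℕ) {m n : ℕ} (f : H m n),
    whiskR l (whiskR k f) = hcast (H := H) (by omega) (by omega) (whiskR (k + l) f)
  whisk_exch : ∀ (k l : ℕ) {m n : ℕ} (f : H m n),
    whiskL k (whiskR l f) = hcast (H := H) (by omega) (by omega) (whiskR l (whiskL k f))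
  sym : ∀ m n : ℕ, H (m + n) (n + m)
  sym_sym : ∀ m n : ℕ, comp (sym m n) (sym n m) = id (m + n)
  sym_natL : ∀ {m n : ℕ} (k : ℕ) (f : H m n),
    comp (whiskR k f) (sym n k) = comp (sym m k) (whiskL k f)
  sym_natR : ∀ {m n : ℕ} (k : ℕ) (f : H m n),
    comp (whiskL k f) (sym k n) = comp (sym k m) (whiskR k f)
  sym_add : ∀ m n k : ℕ,
    sym (m + n) k =
      hcast (H := H) rfl (by omega)
        (comp
          ((hcast (H := H) (by omega) (by omega) (whiskL m (sym n k)) :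
            H (m + n + k) (m + k + n)))
          (whiskR n (sym m k)))

/-- Tensor product of morphisms in a pre-PROP (defined via whiskering). -/
def PrePROPOn.tens {H : ℕ → ℕ → Type} (S : PrePROPOn H) {a b c d : ℕ}
    (f : H a b) (g : H c d) : H (a + c) (b + d) :=
  S.comp (S.whiskR c f) (S.whiskL b g)

/-- Centrality of a morphism of a pre-PROP: its whiskered composites with any morphism
in either order agree. -/
def PrePROPOn.Central {H : ℕ → ℕ → Type} (S : PrePROPOn H) {m n : ℕ} (f : H m n) : Prop :=
  ∀ {m' n' : ℕ} (g : H m' n'),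
    S.comp (S.whiskR m' f) (S.whiskL n g) = S.comp (S.whiskL m g) (S.whiskR n' f) ∧
    S.comp (S.whiskL m' f) (S.whiskR n g) = S.comp (S.whiskR m g) (S.whiskL n' f)

/-- A cartesian PROP structure: a pre-PROP in which every morphism is central, equipped
with natural commutative-comonoid structures (copy and discard) satisfying the comonoid
coherence laws. -/
structure CartPROPOn (H : ℕ → ℕ → Type) extends PrePROPOn H where
  allCentral : ∀ {m n : ℕ} (f : H m n), toPrePROPOn.Central f
  copy : ∀ n : ℕ, H n (n + n)
  discard : ∀ n : ℕ, H n 0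
  copy_counitL : ∀ n : ℕ,
    comp (copy n) (whiskR n (discard n)) = hcast (H := H) rfl (by omega) (id n)
  copy_counitR : ∀ n : ℕ, comp (copy n) (whiskL n (discard n)) = id n
  copy_coassoc : ∀ n : ℕ,
    comp (copy n) (whiskR n (copy n)) =
      hcast (H := H) rfl (by omega) (comp (copy n) (whiskL n (copy n)))
  copy_comm : ∀ n : ℕ, comp (copy n) (sym n n) = copy n
  copy_natural : ∀ {m n : ℕ} (f : H m n),
    comp f (copy n) = comp (copy m) (toPrePROPOn.tens f f)
  discard_natural : ∀ {m n : ℕ} (f : H m n), comp f (discard n) = discard m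
  copy_add : ∀ m n : ℕ,
    copy (m + n) =
      comp (toPrePROPOn.tens (copy m) (copy n))
        ((hcast (H := H) (by omega) (by omega) (whiskL m (whiskR n (sym m n))) :
          H (m + m + (n + n)) (m + n + (m + n))))
  discard_add : ∀ m n : ℕ, discard (m + n) = toPrePROPOn.tens (discard m) (discard n)

/-- A strict symmetric premonoidal identity-on-objects functor between pre-PROP
structures. -/
structure PrePROPHomOn {H₁ H₂ : ℕ → ℕ → Type} (S₁ : PrePROPOn H₁) (S₂ : PrePROPOn H₂) where
  map : ∀ {m n : ℕ}, H₁ m n → H₂ m n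
  map_id : ∀ n : ℕ, map (S₁.id n) = S₂.id n
  map_comp : ∀ {a b c : ℕ} (f : H₁ a b) (g : H₁ b c), map (S₁.comp f g) = S₂.comp (map f) (map g)
  map_whiskL : ∀ (k : ℕ) {m n : ℕ} (f : H₁ m n), map (S₁.whiskL k f) = S₂.whiskL k (map f)
  map_whiskR : ∀ (k : ℕ) {m n : ℕ} (f : H₁ m n), map (S₁.whiskR k f) = S₂.whiskR k (map f)
  map_sym : ∀ m n : ℕ, map (S₁.sym m n) = S₂.sym m n

/-- Composition of pre-PROP functors. -/
def PrePROPHomOn.comp {H₁ H₂ H₃ : ℕ → ℕ → Type} {S₁ : PrePROPOn H₁} {S₂ : PrePROPOn H₂}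
    {S₃ : PrePROPOn H₃} (F : PrePROPHomOn S₁ S₂) (G : PrePROPHomOn S₂ S₃) :
    PrePROPHomOn S₁ S₃ where
  map f := G.map (F.map f)
  map_id n := by show G.map (F.map _) = _; rw [F.map_id, G.map_id]
  map_comp f g := by show G.map (F.map _) = _; rw [F.map_comp, G.map_comp]
  map_whiskL := by
    intro k m n f
    show G.map (F.map _) = _; rw [F.map_whiskL, G.map_whiskL]
  map_whiskR := by
    intro k m n f
    show G.map (F.map _) = _; rw [F.map_whiskR, G.map_whiskR]
  map_sym m n := by show G.map (F.map _) = _; rw [F.map_sym, G.map_sym]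

/-- A Freyd PROP structure on a pair of hom-families: a cartesian PROP of values, a
pre-PROP of computations, and an identity-on-objects strict symmetric premonoidal
functor `J` with central image. -/
structure FreydPROPOn (HV HC : ℕ → ℕ → Type) where
  Vp : CartPROPOn HV
  Cp : PrePROPOn HC
  J : PrePROPHomOn Vp.toPrePROPOn Cp
  J_central : ∀ {m n : ℕ} (f : HV m n), Cp.Central (J.map f)

/-- A (bundled) Freyd PROP. -/
structure FreydPROP where
  HV : ℕ → ℕ → Type
  HC : ℕ → ℕ → Type
  str : FreydPROPOn HV HC

/-- A Freyd PROP functor: a pair of identity-on-objects strict symmetric premonoidal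
functors, the value part preserving copy and discard, commuting with the functors `J`. -/
structure FreydPROPHomOn {HV₁ HC₁ HV₂ HC₂ : ℕ → ℕ → Type}
    (A : FreydPROPOn HV₁ HC₁) (B : FreydPROPOn HV₂ HC₂) where
  mapV : PrePROPHomOn A.Vp.toPrePROPOn B.Vp.toPrePROPOn
  mapC : PrePROPHomOn A.Cp B.Cp
  mapV_copy : ∀ n : ℕ, mapV.map (A.Vp.copy n) = B.Vp.copy n
  mapV_discard : ∀ n : ℕ, mapV.map (A.Vp.discard n) = B.Vp.discard n
  squareJ : ∀ {m n : ℕ} (f : HV₁ m n), mapC.map (A.J.map f) = B.J.map (mapV.map f)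

/-- Composition of Freyd PROP functors. -/
def FreydPROPHomOn.comp {HV₁ HC₁ HV₂ HC₂ HV₃ HC₃ : ℕ → ℕ → Type}
    {A : FreydPROPOn HV₁ HC₁} {B : FreydPROPOn HV₂ HC₂} {Cs : FreydPROPOn HV₃ HC₃}
    (F : FreydPROPHomOn A B) (G : FreydPROPHomOn B Cs) : FreydPROPHomOn A Cs where
  mapV := F.mapV.comp G.mapV
  mapC := F.mapC.comp G.mapC
  mapV_copy n := by show G.mapV.map (F.mapV.map _) = _; rw [F.mapV_copy, G.mapV_copy]
  mapV_discard n := by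
    show G.mapV.map (F.mapV.map _) = _; rw [F.mapV_discard, G.mapV_discard]
  squareJ f := by
    show G.mapC.map (F.mapC.map _) = _
    rw [F.squareJ, G.squareJ]; rfl

/-- A cartesian PROP structure on `CSUB[V]` is induced by the substitution construction
when its identities, composition, whiskerings, symmetries, copy and discard are given on
representatives by the empty word, concatenation, stepwise padding and singleton
renaming words. -/
def InducedV (V : CartOperad) (S : CartPROPOn (CSUBQ V)) : Prop :=
  (∀ n : ℕ, S.id n = Quot.mk _ PreSub.nil) ∧
  (∀ {m k n : ℕ} (t : PreSub V.C m k) (s : PreSub V.C k n),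
    S.comp (Quot.mk _ t) (Quot.mk _ s) = Quot.mk _ (s.append t)) ∧
  (∀ (l : ℕ) {m n : ℕ} (s : PreSub V.C m n),
    S.whiskL l (Quot.mk _ s) = Quot.mk _ (s.whiskL l)) ∧
  (∀ (l : ℕ) {m n : ℕ} (s : PreSub V.C m n),
    S.whiskR l (Quot.mk _ s) = Quot.mk _ (s.whiskR l)) ∧
  (∀ m n : ℕ, S.sym m n = Quot.mk _ (PreSub.renCons (swapRen n m) PreSub.nil)) ∧
  (∀ n : ℕ, S.copy n = Quot.mk _ (PreSub.renCons (copyRen n) PreSub.nil)) ∧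
  (∀ n : ℕ, S.discard n = Quot.mk _ (PreSub.renCons (discardRen n) PreSub.nil))

/-- A pre-PROP structure on `SUB[C]` is induced by the substitution construction when
its identities, composition, whiskerings and symmetries are given on representatives by
the empty word, concatenation, stepwise padding and singleton renaming words. -/
def InducedC (P : SymRenPreoperad) (S : PrePROPOn (SUBQ P)) : Prop :=
  (∀ n : ℕ, S.id n = Quot.mk _ PreSub.nil) ∧
  (∀ {m k n : ℕ} (t : PreSub P.C m k) (s : PreSub P.C k n),
    S.comp (Quot.mk _ t) (Quot.mk _ s) = Quot.mk _ (s.append t)) ∧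
  (∀ (l : ℕ) {m n : ℕ} (s : PreSub P.C m n),
    S.whiskL l (Quot.mk _ s) = Quot.mk _ (s.whiskL l)) ∧
  (∀ (l : ℕ) {m n : ℕ} (s : PreSub P.C m n),
    S.whiskR l (Quot.mk _ s) = Quot.mk _ (s.whiskR l)) ∧
  (∀ m n : ℕ, S.sym m n = Quot.mk _ (PreSub.renCons (swapRen n m) PreSub.nil))

/-- A Freyd PROP structure on `(CSUB[V], SUB[C])` is induced by the substitution
construction when both components are and when `J` is given on representatives by
applying `I` to each substitution step of a word. -/
def Induced (O : FreydOperad) (S : FreydPROPOn (CSUBQ O.V) (SUBQ O.C)) : Prop :=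
  InducedV O.V S.Vp ∧ InducedC O.C S.Cp ∧
  (∀ {m n : ℕ} (s : PreSub O.V.C m n),
    S.J.map (Quot.mk _ s) = Quot.mk _ (PreSub.mapWord (fun {k} (g : O.V.C k) => O.I.map g) s))

/-- A Freyd PROP functor between induced substitution Freyd PROPs is induced by a Freyd
operad functor `φ` when it acts on representatives by applying `φ` to each substitution
step of a word. -/
def InducedHom {O₁ O₂ : FreydOperad} (φ : FreydOperadHom O₁ O₂)
    {A : FreydPROPOn (CSUBQ O₁.V) (SUBQ O₁.C)} {B : FreydPROPOn (CSUBQ O₂.V) (SUBQ O₂.C)}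
    (G : FreydPROPHomOn A B) : Prop :=
  (∀ {m n : ℕ} (s : PreSub O₁.V.C m n),
    G.mapV.map (Quot.mk _ s) =
      Quot.mk _ (PreSub.mapWord (fun {k} (g : O₁.V.C k) => φ.mapV.map g) s)) ∧
  (∀ {m n : ℕ} (s : PreSub O₁.C.C m n),
    G.mapC.map (Quot.mk _ s) =
      Quot.mk _ (PreSub.mapWord (fun {k} (g : O₁.C.C k) => φ.mapC.map g) s))

/-- Witness that the Freyd operad `O` is the Freyd operad of morphisms with codomain `1`
of the Freyd PROP `P`: the carriers are the hom-sets into `1`, operadic composition is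
given by whiskering and composition, reindexing by precomposition with the interpretation
of renamings (via `J` in the computation part), and `I` by restriction of `J`. -/
structure ForgetData (P : FreydPROP) (O : FreydOperad) where
  eV : ∀ n : ℕ, O.V.C n ≃ P.HV n 1
  eC : ∀ n : ℕ, O.C.C n ≃ P.HC n 1
  /-- interpretation of a renaming `r : m → n` as a morphism `n → m` of the value PROP -/
  interp : ∀ {m n : ℕ}, Ren m n → P.HV n m
  interp_id : ∀ n : ℕ, interp (idRen n) = P.str.Vp.id n
  interp_comp : ∀ {m n k : ℕ} (r₁ : Ren m n) (r₂ : Ren n k),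
    interp (r₂ ∘ r₁) = P.str.Vp.comp (interp r₂) (interp r₁)
  interp_swap : ∀ m n : ℕ, interp (swapRen m n) = P.str.Vp.sym n m
  interp_copy : ∀ n : ℕ, interp (copyRen n) = P.str.Vp.copy n
  interp_discard : ∀ n : ℕ, interp (discardRen n) = P.str.Vp.discard n
  interp_bsum : ∀ {m₁ n₁ m₂ n₂ : ℕ} (r : Ren m₁ n₁) (r' : Ren m₂ n₂),
    interp (bsum r r') = P.str.Vp.tens (interp r) (interp r')
  one_eV : eV 1 O.V.one = P.str.Vp.id 1
  one_eC : eC 1 O.C.one = P.str.Cp.id 1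
  subst_eV : ∀ {n₁ n₂ m : ℕ} (f : O.V.C (n₁ + 1 + n₂)) (g : O.V.C m),
    eV _ (O.V.subst n₁ n₂ f g) =
      hcast (H := P.HV) (by omega) rfl
        (P.str.Vp.comp (P.str.Vp.whiskL n₁ (P.str.Vp.whiskR n₂ (eV _ g)))
          (hcast (H := P.HV) (by omega) rfl (eV _ f)))
  subst_eC : ∀ {n₁ n₂ m : ℕ} (f : O.C.C (n₁ + 1 + n₂)) (g : O.C.C m),
    eC _ (O.C.subst n₁ n₂ f g) =
      hcast (H := P.HC) (by omega) rfl
        (P.str.Cp.comp (P.str.Cp.whiskL n₁ (P.str.Cp.whiskR n₂ (eC _ g)))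
          (hcast (H := P.HC) (by omega) rfl (eC _ f)))
  ren_eV : ∀ {m n : ℕ} (f : O.V.C m) (r : Ren m n),
    eV _ (O.V.ren f r) = P.str.Vp.comp (interp r) (eV _ f)
  ren_eC : ∀ {m n : ℕ} (f : O.C.C m) (r : Ren m n),
    eC _ (O.C.ren f r) = P.str.Cp.comp (P.str.J.map (interp r)) (eC _ f)
  J_compat : ∀ {n : ℕ} (v : O.V.C n), eC _ (O.I.map v) = P.str.J.map (eV _ v)

/-- Compatibility of a forgetful action on morphisms: the value and computation parts of
`φ` correspond, through the forgetful witnesses, to the restriction of `ψ` to morphisms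
with codomain `1`. -/
def UmorCompat {P₁ P₂ : FreydPROP} {O₁ O₂ : FreydOperad}
    (D₁ : ForgetData P₁ O₁) (D₂ : ForgetData P₂ O₂)
    (ψ : FreydPROPHomOn P₁.str P₂.str) (φ : FreydOperadHom O₁ O₂) : Prop :=
  (∀ {n : ℕ} (v : O₁.V.C n), D₂.eV n (φ.mapV.map v) = ψ.mapV.map (D₁.eV n v)) ∧
  (∀ {n : ℕ} (c : O₁.C.C n), D₂.eC n (φ.mapC.map c) = ψ.mapC.map (D₁.eC n c))

/-- Uncurrying (value part): interpret a substitution word in the value PROP, sending the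
empty word to the identity, a substitution step `⟨m₁ ⊣ g ⊢ m₂⟩` to the whiskered
morphism `m₁ ⋊ hV g ⋉ m₂`, and a renaming step to its interpretation, multiplicatively
over concatenation. -/
def uncurryV (O : FreydOperad) (P : FreydPROP)
    (interp : ∀ {a b : ℕ}, Ren a b → P.HV b a)
    (hV : ∀ {k : ℕ}, O.V.C k → P.HV k 1) :
    ∀ {m n : ℕ}, PreSub O.V.C m n → P.HV m n
  | _, _, .nil => P.str.Vp.id _
  | _, _, .subCons m₁ m₂ g rest =>
      P.str.Vp.comp (uncurryV O P interp hV rest)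
        (hcast (H := P.HV) (by omega) (by omega)
          (P.str.Vp.whiskL m₁ (P.str.Vp.whiskR m₂ (hV g))))
  | _, _, .renCons r rest =>
      P.str.Vp.comp (uncurryV O P interp hV rest) (interp r)

/-- Uncurrying (computation part): interpret a substitution word in the computation
pre-PROP, renaming steps being interpreted via `J` applied to their value
interpretation. -/
def uncurryC (O : FreydOperad) (P : FreydPROP)
    (iren : ∀ {a b : ℕ}, Ren a b → P.HC b a)
    (hC : ∀ {k : ℕ}, O.C.C k → P.HC k 1) :
    ∀ {m n : ℕ}, PreSub O.C.C m n → P.HC m n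
  | _, _, .nil => P.str.Cp.id _
  | _, _, .subCons m₁ m₂ g rest =>
      P.str.Cp.comp (uncurryC O P iren hC rest)
        (hcast (H := P.HC) (by omega) (by omega)
          (P.str.Cp.whiskL m₁ (P.str.Cp.whiskR m₂ (hC g))))
  | _, _, .renCons r rest =>
      P.str.Cp.comp (uncurryC O P iren hC rest) (iren r)

section Renamings

theorem bsum_val {m₁ n₁ m₂ n₂ : ℕ} (r : Ren m₁ n₁) (r' : Ren m₂ n₂) (i : Fin (m₁ + m₂)) :
    (bsum r r' i).val = if h : i.val < m₁ then (r ⟨i, h⟩).val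
      else n₁ + (r' ⟨i - m₁, by omega⟩).val := by
  refine Fin.addCases (fun a => ?_) (fun b => ?_) i
  · simp [bsum]
  · simp [bsum]

theorem swapRen_val (m n : ℕ) (i : Fin (m + n)) :
    (swapRen m n i).val = if i.val < m then n + i.val else i.val - m := by
  refine Fin.addCases (fun a => ?_) (fun b => ?_) i
  · simp [swapRen]
  · simp [swapRen]

theorem copyRen_val (n : ℕ) (i : Fin (n + n)) :
    (copyRen n i).val = if i.val < n then i.val else i.val - n := by
  refine Fin.addCases (fun a => ?_) (fun b => ?_) i
  · simp [copyRen]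
  · rw [copyRen, Fin.addCases_right]; simp

/-- The renaming exchanging the adjacent blocks of sizes `k` and `q` that start at
position `p`. -/
def blockSwap (p k q : ℕ) {a b : ℕ} (h : p + k + q ≤ a) (hab : a = b) : Ren a b := fun i =>
  ⟨if i.val < p then i.val else if i.val < p + k then i.val + q
    else if i.val < p + k + q then i.val - k else i.val, by split_ifs <;> omega⟩

/-- The renaming `m + (n + m) → n + m` identifying the two outer blocks. -/
def fuse (m n : ℕ) : Ren (m + (n + m)) (n + m) := fun i =>
  ⟨if i.val < m then n + i.val else i.val - m, by split_ifs <;> omega⟩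

/-- The renaming identifying the adjacent blocks of size `n` that start at position `p`. -/
def blockCopy (p n : ℕ) {a b : ℕ} (h : p + n ≤ b) (hab : a = b + n) : Ren a b := fun i =>
  ⟨if i.val < p + n then i.val else i.val - n, by split_ifs <;> omega⟩

/-- A renaming fixing an initial block of size `p` and acting as `φ` afterwards. -/
def shiftRen (p : ℕ) (φ : ℕ → ℕ) {a b : ℕ} (h : ∀ i, p + i < a → p + φ i < b)
    (hab : p ≤ b) : Ren a b := fun i =>
  ⟨if i.val < p then i.val else p + φ (i.val - p), by
    split_ifs with hi
    · omega
    · exact h _ (by omega)⟩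

end Renamings

section Casts

theorem PreSub.apply_castU (P : RenPreoperad) {m n n' : ℕ} (h : n = n') (s : PreSub P.C m n)
    (f : P.C n') : (PreSub.castU h s).apply P f = s.apply P (acast (C := P.C) h.symm f) := by
  subst h; rfl

theorem acast_acast {C : ℕ → Type u} {a b c : ℕ} (h : a = b) (h' : b = c) (x : C a) :
    acast (C := C) h' (acast (C := C) h x) = acast (C := C) (h.trans h') x := by
  subst h h'; rfl

theorem acast_eq_ren (P : RenPreoperad) {a b : ℕ} (h : a = b) (x : P.C a) :
    acast (C := P.C) h x = P.ren x (Fin.cast h) := by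
  subst h; exact (P.ren_id x).symm

/-- A substitution step whose arities are only propositionally of the required shape. -/
def PreSub.subAt {C : ℕ → Type} {m k n n' : ℕ} (m₁ m₂ : ℕ) (h : n = m₁ + 1 + m₂)
    (h' : n' = m₁ + k + m₂) (g : C k) (rest : PreSub C m n') : PreSub C m n :=
  PreSub.castU h.symm (.subCons m₁ m₂ g (PreSub.castU h' rest))

end Casts

section Soundness

variable {V : CartOperad}

/-- The action of words on elements is invariant under the cartesian congruence. -/
theorem CSubEquiv.apply_eq {m n : ℕ} {s t : PreSub V.C m n} (h : CSubEquiv V s t) (f : V.C n) :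
    s.apply V.toRenPreoperad f = t.apply V.toRenPreoperad f := by
  induction h with
  | refl => rfl
  | symm _ ih => exact (ih f).symm
  | trans _ _ ih₁ ih₂ => exact (ih₁ f).trans (ih₂ f)
  | congrSub g _ ih => simp only [PreSub.apply]; exact ih _
  | congrRen r _ ih => simp only [PreSub.apply]; exact ih _
  | unit₁ s =>
    simp only [PreSub.apply]
    rw [V.right_unit]
  | unit₂ s =>
    simp only [PreSub.apply]
    rw [V.ren_id]
  | merge g h rest =>
    simp only [PreSub.apply, PreSub.apply_castU]
    rw [V.assoc]
  | renComp r₁ r₂ rest =>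
    simp only [PreSub.apply]
    rw [V.ren_comp]
  | interchange v ρ₁ ρ ρ₂ rest =>
    simp only [PreSub.apply]
    rw [V.ren_subst]
  | symL g rest =>
    simp only [PreSub.apply, PreSub.apply_castU]
    rw [V.sym_nat₁]
  | symR g rest =>
    simp only [PreSub.apply, PreSub.apply_castU]
    rw [V.sym_nat₂]; rfl
  | @cen m₁ m m₂ _ _ g₁ g₂ rest =>
    simp only [PreSub.apply, PreSub.apply_castU]
    have := (V.central g₁ g₂ m₁ m m₂ (acast (C := V.C) (by omega) f)).1
    rw [← this, acast_acast]; rfl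
  | dis g rest =>
    simp only [PreSub.apply]
    rw [V.discard_nat]
  | cop g rest =>
    simp only [PreSub.apply, PreSub.apply_castU]
    rw [V.copy_nat]

end Soundness

section GeneralRules

variable {V : CartOperad}

open PreSub

theorem PreSub.castU_renCons_castU {C : ℕ → Type} {m a b a' b' : ℕ} (ha : a = a') (hb : b' = b)
    (r : Ren a b) (r' : Ren a' b') (h : ∀ i, (r' i).val = (r (Fin.cast ha.symm i)).val)
    (rest : PreSub C m b') :
    castU ha (.renCons r (castU hb rest)) = .renCons r' rest := by
  subst ha hb
  obtain rfl : r' = r := funext fun i => Fin.ext (h i)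
  rfl

theorem CSubEquiv.congrSubAt {m k n n' m₁ m₂ : ℕ} (h : n = m₁ + 1 + m₂) (h' : n' = m₁ + k + m₂)
    (g : V.C k) {s t : PreSub V.C m n'} (e : CSubEquiv V s t) :
    CSubEquiv V (subAt m₁ m₂ h h' g s) (subAt m₁ m₂ h h' g t) := by
  subst h h'; exact .congrSub g e

theorem CSubEquiv.subAt_one {m n n' m₁ m₂ : ℕ} (h : n = m₁ + 1 + m₂) (h' : n' = m₁ + 1 + m₂)
    (hn : n' = n) (s : PreSub V.C m n') :
    CSubEquiv V (subAt m₁ m₂ h h' V.one s) (castU hn s) := by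
  subst h h'; exact .unit₁ s

theorem CSubEquiv.subAt_merge {m m₁ m₂ n₁ n₂ k p₁ p₂ n n' n'' : ℕ}
    (g : V.C (n₁ + 1 + n₂)) (h : V.C k) (e₁ : n = m₁ + 1 + m₂)
    (e₂ : n' = m₁ + (n₁ + 1 + n₂) + m₂) (hp₁ : p₁ = m₁ + n₁) (hp₂ : p₂ = n₂ + m₂)
    (e₃ : n' = p₁ + 1 + p₂) (e₄ : n'' = p₁ + k + p₂) (e₅ : n'' = m₁ + (n₁ + k + n₂) + m₂)
    (rest : PreSub V.C m n'') :
    CSubEquiv V (subAt m₁ m₂ e₁ e₂ g (subAt p₁ p₂ e₃ e₄ h rest))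
      (subAt m₁ m₂ e₁ e₅ (V.subst n₁ n₂ g h) rest) := by
  subst e₁ e₂ hp₁ hp₂ e₄
  exact .merge g h rest

theorem CSubEquiv.ren_trans {m a b c : ℕ} {r₁ : Ren a b} {r₂ : Ren b c} {r : Ren a c}
    (h : ∀ i, (r i).val = (r₂ (r₁ i)).val) (rest : PreSub V.C m c) :
    CSubEquiv V (.renCons r₁ (.renCons r₂ rest)) (.renCons r rest) := by
  obtain rfl : r = r₂ ∘ r₁ := funext fun i => Fin.ext (h i)
  exact .renComp r₁ r₂ rest

theorem CSubEquiv.ren_self {m n : ℕ} {r : Ren n n} (h : ∀ i, (r i).val = i.val)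
    (s : PreSub V.C m n) : CSubEquiv V (.renCons r s) s := by
  obtain rfl : r = idRen n := funext fun i => Fin.ext (h i)
  exact .unit₂ s

theorem CSubEquiv.ren_subAt {m n₁ n₂ k a b c A B A' B' : ℕ} (v : V.C k)
    (ρ₁ : Ren n₁ a) (ρ : Ren k b) (ρ₂ : Ren n₂ c) (hA : A = n₁ + 1 + n₂) (hB : B = a + 1 + c)
    (hA' : A' = n₁ + k + n₂) (hB' : B' = a + b + c) {R : Ren A B} {R' : Ren A' B'}
    (hR : ∀ i, (R i).val = (bsum (bsum ρ₁ (idRen 1)) ρ₂ (Fin.cast hA i)).val)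
    (hR' : ∀ i, (R' i).val = (bsum (bsum ρ₁ ρ) ρ₂ (Fin.cast hA' i)).val)
    (rest : PreSub V.C m B') :
    CSubEquiv V (.renCons R (subAt a c hB hB' (V.ren v ρ) rest))
      (subAt n₁ n₂ hA hA' v (.renCons R' rest)) := by
  subst hA hB hA' hB'
  obtain rfl : R = bsum (bsum ρ₁ (idRen 1)) ρ₂ := funext fun i => Fin.ext (hR i)
  obtain rfl : R' = bsum (bsum ρ₁ ρ) ρ₂ := funext fun i => Fin.ext (hR' i)
  exact (CSubEquiv.interchange v ρ₁ ρ ρ₂ rest).symm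

/-- A renaming acting to the right of position `p` slides past a substitution at `p`. -/
theorem CSubEquiv.shiftRen_subAt {m p k c₁ c₂ A B A' B' : ℕ} (g : V.C k)
    (hA : A = p + 1 + c₁) (hB : B = p + 1 + c₂) (hA' : A' = p + k + c₁) (hB' : B' = p + k + c₂)
    {R : Ren A B} {R' : Ren A' B'} (φ : ℕ → ℕ) (hφ : ∀ i < c₁, φ i < c₂)
    (hR : ∀ i, (R i).val = if i.val < p + 1 then i.val else p + 1 + φ (i.val - (p + 1)))
    (hR' : ∀ i, (R' i).val = if i.val < p + k then i.val else p + k + φ (i.val - (p + k)))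
    (rest : PreSub V.C m B') :
    CSubEquiv V (.renCons R (subAt p c₂ hB hB' g rest))
      (subAt p c₁ hA hA' g (.renCons R' rest)) := by
  have := CSubEquiv.ren_subAt g (idRen p) (idRen k)
    (fun i : Fin c₁ => (⟨φ i.val, hφ _ i.isLt⟩ : Fin c₂)) hA hB hA' hB' (R := R) (R' := R')
    (fun i => ?_) (fun i => ?_) rest
  · rwa [V.ren_id] at this
  · rw [hR]
    simp only [bsum_val, idRen, Fin.val_cast]
    split_ifs <;> omega
  · rw [hR']
    simp only [bsum_val, idRen, Fin.val_cast]
    split_ifs <;> omega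

theorem CSubEquiv.blockSwap_one_one_subAt {m p k s s' A A' B B' q : ℕ} (g : V.C k)
    (hq : q = p + 1) (hs : s' = 1 + s) (h₁ : p + 1 + 1 ≤ A) (hAB : A = B)
    (hB : B = q + 1 + s) (hB' : B' = q + k + s) (hA : A = p + 1 + s') (hA' : A' = p + k + s')
    (h₂ : p + k + 1 ≤ A') (hAB' : A' = B') (rest : PreSub V.C m B') :
    CSubEquiv V (.renCons (blockSwap p 1 1 h₁ hAB) (subAt q s hB hB' g rest))
      (subAt p s' hA hA' g (.renCons (blockSwap p k 1 h₂ hAB') rest)) := by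
  subst hq hs hB hAB hB' hA'
  have := CSubEquiv.symR g rest
  rw [castU_renCons_castU _ _ _ (blockSwap p k 1 h₂ hAB')] at this
  · have hr : blockSwap p 1 1 h₁ rfl =
        (bsum (bsum (idRen p) (swapRen 1 1)) (idRen s) : Ren (p + (1 + 1) + s) _) := by
      funext i
      ext
      simp only [blockSwap, bsum_val, swapRen_val, idRen]
      split_ifs <;> omega
    rw [hr]
    exact this
  · intro i
    simp only [blockSwap, bsum_val, swapRen_val, idRen, Fin.val_cast]
    split_ifs <;> omega

theorem CSubEquiv.subAt_comm {m' m₁ p₁ c₁ c₂ p₂ m₂ n₁ n₂ A B B' D : ℕ}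
    (g₁ : V.C n₁) (g₂ : V.C n₂) (l : ℕ)
    (hc₁ : c₁ = l + 1 + m₂) (hp₁ : p₁ = m₁ + n₁ + l)
    (hc₂ : c₂ = l + n₂ + m₂) (hp₂ : p₂ = m₁ + 1 + l)
    (h₁ : A = m₁ + 1 + c₁) (h₂ : B = m₁ + n₁ + c₁) (h₃ : B = p₁ + 1 + m₂) (h₄ : D = p₁ + n₂ + m₂)
    (h₅ : A = p₂ + 1 + m₂) (h₆ : B' = p₂ + n₂ + m₂) (h₇ : B' = m₁ + 1 + c₂)
    (h₈ : D = m₁ + n₁ + c₂) (rest : PreSub V.C m' D) :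
    CSubEquiv V (subAt m₁ c₁ h₁ h₂ g₁ (subAt p₁ m₂ h₃ h₄ g₂ rest))
      (subAt p₂ m₂ h₅ h₆ g₂ (subAt m₁ c₂ h₇ h₈ g₁ rest)) := by
  subst hc₁ hp₁ hc₂ hp₂ h₁ h₂ h₄ h₆
  exact .cen g₁ g₂ rest

theorem CSubEquiv.discard_subAt {m m₁ m₂ n A B B' : ℕ} (g : V.C n)
    (hA : A = m₁ + m₂) (hB : B = m₁ + 1 + m₂) (hB' : B' = m₁ + n + m₂)
    {R : Ren A B} {R' : Ren A B'}
    (hR : ∀ i, (R i).val = if i.val < m₁ then i.val else i.val + 1)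
    (hR' : ∀ i, (R' i).val = if i.val < m₁ then i.val else i.val + n)
    (rest : PreSub V.C m B') :
    CSubEquiv V (.renCons R (subAt m₁ m₂ hB hB' g rest)) (.renCons R' rest) := by
  subst hA hB hB'
  obtain rfl : R = (bsum (bsum (idRen m₁) (discardRen 1)) (idRen m₂) :
      Ren (m₁ + 0 + m₂) (m₁ + 1 + m₂)) := by
    funext i
    ext
    rw [hR, bsum_val]
    split_ifs with h₁ h₂ h₂
    · rw [bsum_val, dif_pos h₁]; rfl
    · omega
    · omega
    · simp only [idRen]; omega
  obtain rfl : R' = (bsum (bsum (idRen m₁) (discardRen n)) (idRen m₂) :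
      Ren (m₁ + 0 + m₂) (m₁ + n + m₂)) := by
    funext i
    ext
    rw [hR', bsum_val]
    split_ifs with h₁ h₂ h₂
    · rw [bsum_val, dif_pos h₁]; rfl
    · omega
    · omega
    · simp only [idRen]; omega
  exact .dis g rest

theorem CSubEquiv.blockCopy_subAt {m m₁ m₂ n p q A B B' D E : ℕ} (g : V.C n)
    (hp : p = m₁ + 1) (hq : q = n + m₂)
    (hB : B = m₁ + 1 + m₂) (hB' : B' = m₁ + n + m₂) (h₁ : m₁ + 1 ≤ B) (hAB : A = B + 1)
    (hA : A = p + 1 + m₂) (hD : D = p + n + m₂) (hD' : D = m₁ + 1 + q) (hE : E = m₁ + n + q)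
    (h₂ : m₁ + n ≤ B') (hEB : E = B' + n) (rest : PreSub V.C m B') :
    CSubEquiv V (.renCons (blockCopy m₁ 1 h₁ hAB) (subAt m₁ m₂ hB hB' g rest))
      (subAt p m₂ hA hD g (subAt m₁ q hD' hE g (.renCons (blockCopy m₁ n h₂ hEB) rest))) := by
  subst hp hq hA hB hB' hD
  have hr : blockCopy m₁ 1 h₁ hAB = (bsum (bsum (idRen m₁) (copyRen 1)) (idRen m₂) :
      Ren (m₁ + (1 + 1) + m₂) (m₁ + 1 + m₂)) := by
    funext i
    ext
    simp only [blockCopy, bsum_val, copyRen_val, idRen]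
    split_ifs <;> omega
  have h := CSubEquiv.cop g rest
  have hc := castU_renCons_castU (show m₁ + (n + n) + m₂ = E by omega) rfl
    (bsum (bsum (idRen m₁) (copyRen n)) (idRen m₂)) (blockCopy m₁ n h₂ hEB) (fun i => by
      simp only [blockCopy, bsum_val, copyRen_val, idRen, Fin.val_cast]
      split_ifs <;> omega) rest
  rw [hr, ← hc]
  subst hE
  exact h

end GeneralRules

section Crossing

variable {V : CartOperad}

open PreSub

theorem blockSwap_val (p k q : ℕ) {a b : ℕ} (h : p + k + q ≤ a) (hab : a = b) (i : Fin a) :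
    (blockSwap p k q h hab i).val = if i.val < p then i.val else if i.val < p + k then i.val + q
      else if i.val < p + k + q then i.val - k else i.val := rfl

theorem fuse_val (m n : ℕ) (i : Fin (m + (n + m))) :
    (fuse m n i).val = if i.val < m then n + i.val else i.val - m := rfl

theorem blockCopy_val (p n : ℕ) {a b : ℕ} (h : p + n ≤ b) (hab : a = b + n) (i : Fin a) :
    (blockCopy p n h hab i).val = if i.val < p + n then i.val else i.val - n := rfl

theorem shiftRen_val (p : ℕ) (φ : ℕ → ℕ) {a b : ℕ} (h : ∀ i, p + i < a → p + φ i < b)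
    (hab : p ≤ b) (i : Fin a) :
    (shiftRen p φ h hab i).val = if i.val < p then i.val else p + φ (i.val - p) := rfl

/-- A substituted variable moves to the right past a block of `q` variables. -/
theorem CSubEquiv.blockSwap_one_subAt {m k : ℕ} (g : V.C k) (q : ℕ) {p t s s' A A' B B' : ℕ}
    (ht : t = p + q) (hs : s' = q + s) (h₁ : p + 1 + q ≤ A) (hAB : A = B)
    (hB : B = t + 1 + s) (hB' : B' = t + k + s) (hA : A = p + 1 + s') (hA' : A' = p + k + s')
    (h₂ : p + k + q ≤ A') (hAB' : A' = B') (rest : PreSub V.C m B') :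
    CSubEquiv V (.renCons (blockSwap p 1 q h₁ hAB) (subAt t s hB hB' g rest))
      (subAt p s' hA hA' g (.renCons (blockSwap p k q h₂ hAB') rest)) := by
  induction q generalizing p s' A A' with
  | zero =>
    obtain rfl : t = p := by omega
    obtain rfl : s' = s := by omega
    subst hAB hAB'
    refine (CSubEquiv.ren_self (fun i => ?_) _).trans
      (.congrSubAt _ _ _ (CSubEquiv.ren_self (fun i => ?_) _).symm) <;>
    · rw [blockSwap_val]; split_ifs <;> omega
  | succ q ih =>
    refine (CSubEquiv.ren_trans (r₁ := blockSwap p 1 1 (a := A) (b := A) (by omega) rfl)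
      (r₂ := blockSwap (p + 1) 1 q (by omega) hAB) (fun i => ?_) _).symm.trans ?_
    · simp only [blockSwap_val]; split_ifs <;> omega
    refine (CSubEquiv.congrRen _ (ih (A' := p + 1 + k + (q + s)) (by omega) rfl (by omega) hAB
      (by omega) rfl (by omega) (by omega))).trans ?_
    refine (CSubEquiv.blockSwap_one_one_subAt g rfl (by omega) (by omega) rfl (by omega) rfl hA
      hA' (by omega) (by omega) _).trans (.congrSubAt _ _ _ (CSubEquiv.ren_trans (fun i => ?_) _))
    simp only [blockSwap_val]; split_ifs <;> omega

/-- A substituted variable moves to the left past a block of `q` variables. -/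
theorem CSubEquiv.blockSwap_subAt {m k : ℕ} (g : V.C k) (q : ℕ) {p t s s' A A' B B' : ℕ}
    (ht : t = p + q) (hs : s' = q + s) (h₁ : p + q + 1 ≤ A) (hAB : A = B)
    (hB : B = p + 1 + s') (hB' : B' = p + k + s') (hA : A = t + 1 + s) (hA' : A' = t + k + s)
    (h₂ : p + q + k ≤ A') (hAB' : A' = B') (rest : PreSub V.C m B') :
    CSubEquiv V (.renCons (blockSwap p q 1 h₁ hAB) (subAt p s' hB hB' g rest))
      (subAt t s hA hA' g (.renCons (blockSwap p q k h₂ hAB') rest)) := by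
  subst hAB hAB'
  refine .trans (.symm (.congrRen _ ?_)) (.trans (CSubEquiv.ren_trans
    (r₂ := blockSwap p 1 q (by omega) rfl) (r := idRen _) (fun i => ?_) _) (.unit₂ _))
  · refine (CSubEquiv.blockSwap_one_subAt g q ht hs (by omega) rfl hA hA' hB hB'
      (by omega) rfl _).trans (.congrSubAt _ _ _ (.trans (CSubEquiv.ren_trans (r := idRen _)
        (fun i => ?_) _) (.unit₂ _)))
    simp only [blockSwap_val, idRen]; split_ifs <;> omega
  · simp only [blockSwap_val, idRen]; split_ifs <;> omega

/-- Decomposition of `fuse (m₁ + c + m₂) n` isolating the two copies of the block of size `c`. -/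
theorem CSubEquiv.fuse_factor {m m₁ m₂ : ℕ} (c n q : ℕ) (hq : q = m₂ + n + m₁) (φ : ℕ → ℕ)
    (hφ : ∀ i, φ i = if i < m₁ + m₂ then n + i else i - (m₁ + m₂))
    (rest : PreSub V.C m (n + (m₁ + c + m₂))) :
    CSubEquiv V (.renCons (fuse (m₁ + c + m₂) n) rest)
      (.renCons (blockSwap (m₁ + c) q c (b := m₁ + c + (q + m₂) + c) (by omega) (by omega))
        (.renCons (blockCopy m₁ c (b := m₁ + c + (q + m₂)) (by omega) rfl)
          (.renCons (blockSwap 0 m₁ c (b := 0 + c + (m₁ + (q + m₂))) (by omega) (by omega))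
            (.renCons (shiftRen c φ (b := 0 + c + (n + m₁ + m₂))
                (fun i hi => by rw [hφ]; split_ifs <;> omega) (by omega))
              (.renCons (blockSwap 0 c (n + m₁) (by omega) (by omega)) rest))))) := by
  refine .symm (.trans (.congrRen _ (.congrRen _ (.congrRen _ (.renComp _ _ _)))) (.trans
    (.congrRen _ (.congrRen _ (.renComp _ _ _))) (.trans (.congrRen _ (.renComp _ _ _))
      (CSubEquiv.ren_trans (fun i => ?_) _))))
  have hi := i.isLt
  simp only [Function.comp]
  generalize hx₁ : blockSwap (m₁ + c) q c _ _ i = x₁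
  generalize hx₂ : blockCopy m₁ c _ _ x₁ = x₂
  generalize hx₃ : blockSwap 0 m₁ c _ _ x₂ = x₃
  generalize hx₄ : shiftRen c φ _ _ x₃ = x₄
  rw [fuse_val, blockSwap_val]
  replace hx₁ := congrArg Fin.val hx₁
  replace hx₂ := congrArg Fin.val hx₂
  replace hx₃ := congrArg Fin.val hx₃
  replace hx₄ := congrArg Fin.val hx₄
  rw [blockSwap_val] at hx₁ hx₃
  rw [blockCopy_val] at hx₂
  rw [shiftRen_val, hφ] at hx₄
  generalize i.val = j, x₁.val = y₁, x₂.val = y₂, x₃.val = y₃, x₄.val = y₄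
    at hi hx₁ hx₂ hx₃ hx₄ ⊢
  rcases (by omega : j < m₁ ∨ (m₁ ≤ j ∧ j < m₁ + c) ∨ (m₁ + c ≤ j ∧ j < m₁ + c + m₂) ∨
      (m₁ + c + m₂ ≤ j ∧ j < m₁ + c + q) ∨ (m₁ + c + q ≤ j ∧ j < m₁ + c + q + c) ∨
      m₁ + c + q + c ≤ j) with h | ⟨h, h'⟩ | ⟨h, h'⟩ | ⟨h, h'⟩ | ⟨h, h'⟩ | h <;>
  · simp (disch := omega) only [if_pos, if_neg] at hx₁
    simp (disch := omega) only [if_pos, if_neg] at hx₂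
    simp (disch := omega) only [if_pos, if_neg] at hx₃
    simp (disch := omega) only [if_pos, if_neg] at hx₄
    simp (disch := omega) only [if_pos, if_neg]
    omega

/-- Naturality of `fuse` with respect to a substitution step in the identified block. -/
theorem CSubEquiv.fuse_subAt {m m₁ m₂ k : ℕ} (n : ℕ) (g : V.C k)
    (rest : PreSub V.C m (n + (m₁ + k + m₂))) :
    CSubEquiv V (.renCons (fuse (m₁ + 1 + m₂) n)
        (subAt (n + m₁) m₂ (by omega) (by omega) g rest))
      (subAt m₁ (m₂ + (n + (m₁ + 1 + m₂))) (by omega)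
        (show m₁ + k + m₂ + (n + (m₁ + 1 + m₂)) = _ by omega) g
        (subAt (m₁ + k + m₂ + (n + m₁)) m₂ (by omega) (by omega) g
          (.renCons (fuse (m₁ + k + m₂) n) rest))) := by
  obtain ⟨q, hq⟩ : ∃ q, q = m₂ + n + m₁ := ⟨_, rfl⟩
  obtain ⟨φ, hφ⟩ : ∃ φ : ℕ → ℕ, ∀ i, φ i = if i < m₁ + m₂ then n + i else i - (m₁ + m₂) :=
    ⟨_, fun _ => rfl⟩
  refine (CSubEquiv.fuse_factor 1 n q hq φ hφ _).trans ?_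
  refine .trans (.congrRen _ (.congrRen _ (.congrRen _ (.congrRen _
    (CSubEquiv.blockSwap_one_subAt g (n + m₁) (s' := n + m₁ + m₂)
      (A' := 0 + k + (n + m₁ + m₂)) (by omega) (by omega) (by omega) (by omega) _ _ rfl rfl
      (by omega) (by omega) _))))) ?_
  refine .trans (.congrRen _ (.congrRen _ (.congrRen _
    (CSubEquiv.shiftRen_subAt (c₁ := m₁ + (q + m₂)) (A' := 0 + k + (m₁ + (q + m₂)))
      (R' := shiftRen k φ (fun i hi => by rw [hφ]; split_ifs <;> omega) (by omega)) g rfl _ rfl _ φ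
      (fun i hi => by rw [hφ]; split_ifs <;> omega) (fun i => ?_) (fun i => ?_) _)))) ?_
  · simp only [shiftRen_val, Nat.zero_add]
  · simp only [shiftRen_val, Nat.zero_add]
  refine .trans (.congrRen _ (.congrRen _ (CSubEquiv.blockSwap_subAt g m₁ (t := m₁) (s := q + m₂)
    (A' := m₁ + k + (q + m₂)) (by omega) rfl (by omega) (by omega) _ _ rfl rfl (by omega)
    (by omega) _))) ?_
  refine .trans (.congrRen _ (CSubEquiv.blockCopy_subAt g (p := m₁ + 1) (q := k + (q + m₂))
    (D := m₁ + 1 + (k + (q + m₂))) (E := m₁ + k + (q + m₂) + k)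
    rfl rfl _ _ (by omega) rfl (by omega) (by omega) rfl (by omega) (by omega) rfl _)) ?_
  refine .trans (CSubEquiv.blockSwap_subAt g q (t := m₁ + 1 + q) (s := m₂)
    (A' := m₁ + 1 + q + k + m₂) rfl rfl (by omega) (by omega) _ _ (by omega) rfl
    (by omega) (by omega) _) ?_
  refine .trans (.congrSubAt _ _ _ (CSubEquiv.shiftRen_subAt (c₁ := q + k + m₂)
    (A' := m₁ + k + m₂ + (n + (m₁ + k + m₂)))
    (R' := blockSwap (m₁ + k) q k (by omega) (by omega)) g (by omega) _ (by omega) _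
    (fun i => if i < q then i + k else if i < q + k then i - q else i)
    (fun i hi => by split_ifs <;> omega) (fun i => ?_) (fun i => ?_) _)) ?_
  · simp only [blockSwap_val]; split_ifs <;> omega
  · simp only [blockSwap_val]; split_ifs <;> omega
  refine .trans (CSubEquiv.subAt_comm g g q (B := m₁ + k + m₂ + (n + (m₁ + 1 + m₂)))
    (c₁ := m₂ + (n + (m₁ + 1 + m₂))) (p₁ := m₁ + k + m₂ + (n + m₁)) (by omega) (by omega) rfl rfl
    (by omega) (by omega) (by omega) (by omega) _ _ _ _ _).symm ?_
  exact .congrSubAt _ _ _ (.congrSubAt _ _ _ (CSubEquiv.fuse_factor k n q hq φ hφ rest).symm)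

end Crossing

section Completeness

variable {V : CartOperad}

open PreSub

theorem Ren.exists_val {m n : ℕ} (r : Ren m n) :
    ∃ φ : ℕ → ℕ, (∀ i, (r i).val = φ i.val) ∧ ∀ i < m, φ i < n :=
  ⟨fun i => if h : i < m then (r ⟨i, h⟩).val else 0, fun i => by simp, fun i h => by simp [h]⟩

/-- The projection onto the `i`-th variable. -/
def CartOperad.proj (V : CartOperad) {n : ℕ} (i : Fin n) : V.C n := V.ren V.one (fun _ => i)

theorem CartOperad.ren_proj (V : CartOperad) {m n : ℕ} (i : Fin m) (r : Ren m n) :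
    V.ren (V.proj i) r = V.proj (r i) :=
  (V.ren_comp V.one _ r).symm

theorem CSubEquiv.castU_ren {m a b : ℕ} (h : b = a) {R : Ren a b} (hR : ∀ i, (R i).val = i.val)
    (s : PreSub V.C m b) : CSubEquiv V (castU h s) (.renCons R s) := by
  subst h; exact (CSubEquiv.ren_self hR s).symm

theorem PreSub.castU_subCons {C : ℕ → Type} {m m₁ m₂ k n n' p : ℕ} (hp : p = m₁)
    (h : m₁ + 1 + m₂ = n) (h₁ : n = p + 1 + m₂) (h₂ : n' = p + k + m₂) (h' : m₁ + k + m₂ = n')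
    (g : C k) (rest : PreSub C m (m₁ + k + m₂)) :
    castU h (.subCons m₁ m₂ g rest) = subAt p m₂ h₁ h₂ g (castU h' rest) := by
  subst hp h h'; rfl

theorem PreSub.castU_renCons {C : ℕ → Type} {m a b a' b' : ℕ} (ha : a = a') (hb : b = b')
    (r : Ren a b) (r' : Ren a' b') (h : ∀ i, (r' i).val = (r (Fin.cast ha.symm i)).val)
    (rest : PreSub C m b) : castU ha (.renCons r rest) = .renCons r' (castU hb rest) := by
  subst hb; exact castU_renCons_castU ha rfl r r' h rest

/-- Substitute the tuple `x` of elements in the `m` last variables for the first `n` variables,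
then continue with `rest`. -/
def PreSub.substTuple {C : ℕ → Type} {p m : ℕ} :
    ∀ n : ℕ, (Fin n → C m) → PreSub C p m → PreSub C p (n + m)
  | 0, _, rest => castU (by omega) rest
  | n + 1, x, rest => subAt 0 (n + m) (by omega) (show m + (n + m) = _ by omega) (x 0)
      (.renCons (fuse m n) (substTuple n (fun i => x i.succ) rest))

theorem CSubEquiv.substTuple_proj {p m n : ℕ} (r : Fin n → Fin m) {R : Ren (n + m) m}
    (hR : ∀ i, (R i).val = if h : i.val < n then (r ⟨i, h⟩).val else i.val - n)
    (rest : PreSub V.C p m) :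
    CSubEquiv V (substTuple n (fun i => V.proj (r i)) rest) (.renCons R rest) := by
  induction n with
  | zero => exact CSubEquiv.castU_ren _ (fun i => by rw [hR]; simp) _
  | succ n ih =>
    refine (CSubEquiv.unit₂ _).symm.trans ?_
    refine (CSubEquiv.ren_subAt V.one (idRen 0) (fun _ : Fin 1 => r 0) (idRen (n + m))
      (R := idRen (n + 1 + m)) (A' := n + 1 + m) (n₁ := 0) (n₂ := n + m)
      (R' := fun i => ⟨if i.val = 0 then (r 0).val else m + (i.val - 1), by split_ifs <;> omega⟩)
      (by omega) (by omega) (by omega) (by omega) (fun i => ?_) (fun i => ?_) _).trans ?_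
    · simp only [bsum_val, idRen, Fin.val_cast]; split_ifs <;> omega
    · simp [bsum_val, idRen]
    refine (CSubEquiv.subAt_one _ _ rfl _).trans ?_
    refine (CSubEquiv.ren_trans (r := fun i : Fin (n + 1 + m) => (⟨if i.val = 0 then n + (r 0).val
      else i.val - 1, by
        have := (r 0).isLt; split_ifs <;> omega⟩ : Fin (n + m))) (fun i => ?_) _).trans ?_
    · simp only [fuse_val]; split_ifs <;> omega
    refine (CSubEquiv.congrRen _ (ih (fun i => r i.succ) (R := fun i =>
      ⟨if h : i.val < n then (r (Fin.succ ⟨i, h⟩)).val else i.val - n, by split_ifs <;> omega⟩)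
      (fun i => rfl))).trans (CSubEquiv.ren_trans (fun i => ?_) _)
    rw [hR]
    obtain ⟨i, hi⟩ := i
    rcases i with _ | i
    · simp
    · simp

theorem CSubEquiv.substTuple_ren {p m m' n : ℕ} (x : Fin n → V.C m) (ρ : Ren m m')
    (rest : PreSub V.C p m') :
    CSubEquiv V (substTuple n x (.renCons ρ rest))
      (.renCons (bsum (idRen n) ρ) (substTuple n (fun i => V.ren (x i) ρ) rest)) := by
  induction n with
  | zero =>
    simp only [substTuple]
    rw [castU_renCons _ (Nat.zero_add m').symm _ (bsum (idRen 0) ρ)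
      (fun i => by simp [bsum_val]; rfl)]
    exact .refl _
  | succ n ih =>
    obtain ⟨φ, hφ, hb⟩ := Ren.exists_val ρ
    refine (CSubEquiv.congrSubAt _ _ _ (.trans (.congrRen _ (ih _))
      ((CSubEquiv.renComp _ _ _).trans (CSubEquiv.ren_trans
        (r₁ := (bsum ρ (bsum (idRen n) ρ) : Ren (m + (n + m)) (m' + (n + m'))))
        (r₂ := fuse m' n) (fun i => ?_) _).symm))).trans
      (CSubEquiv.ren_subAt (x 0) (idRen 0) ρ (bsum (idRen n) ρ) _ _ _ _
        (fun i => ?_) (fun i => ?_) _).symm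
    · have hi := i.isLt
      simp only [fuse_val, bsum_val, Function.comp, idRen, hφ]
      have h₁ := hb i.val
      have h₂ := hb (i.val - m - n)
      split_ifs <;> (try rw [Nat.add_sub_cancel_left]) <;> omega
    · simp only [bsum_val, idRen, hφ, Fin.val_cast, Nat.add_comm n 1, Nat.sub_sub, Nat.zero_add]
      split_ifs <;> omega
    · simp only [bsum_val, idRen, hφ, Fin.val_cast, Nat.zero_add, Nat.sub_zero]
      split_ifs <;> omega

theorem CSubEquiv.substTuple_subCons {p m₁ m₂ k n : ℕ} (x : Fin n → V.C (m₁ + 1 + m₂)) (g : V.C k)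
    (rest : PreSub V.C p (m₁ + k + m₂)) :
    CSubEquiv V (substTuple n x (.subCons m₁ m₂ g rest))
      (subAt (n + m₁) m₂ (by omega) (by omega) g
        (substTuple n (fun i => V.subst m₁ m₂ (x i) g) rest)) := by
  induction n with
  | zero =>
    simp only [substTuple]
    rw [castU_subCons (Nat.zero_add m₁)]
    exact .refl _
  | succ n ih =>
    refine (CSubEquiv.congrSubAt _ _ _ (.trans (.congrRen _ (ih _))
      (CSubEquiv.fuse_subAt n g _))).trans ?_
    refine (CSubEquiv.subAt_merge (x 0) g _ _ (by omega) rfl _ _ (by omega) _).trans ?_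
    exact CSubEquiv.subAt_comm _ g (n + m₁) (by omega) (by omega) (by omega) (by omega)
      _ _ _ _ _ _ _ _ _

theorem CSubEquiv.castAdd_substTuple {p m n : ℕ} (x : Fin n → V.C m) (s : PreSub V.C p m) :
    CSubEquiv V (.renCons (Fin.castAdd m) (substTuple n x s))
      (.renCons (Fin.castAdd p)
        (substTuple n (fun i => s.apply V.toRenPreoperad (x i)) .nil)) := by
  induction s with
  | nil => simp only [PreSub.apply]; exact .refl _
  | @subCons m₁ m₂ k g rest ih =>
    simp only [PreSub.apply]
    refine (CSubEquiv.congrRen _ (CSubEquiv.substTuple_subCons x g rest)).trans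
      (.trans ?_ (ih _))
    refine (CSubEquiv.ren_trans (r₁ := Fin.castLE (show n ≤ n + m₁ + m₂ by omega))
      (r₂ := fun i => ⟨if i.val < n + m₁ then i.val else i.val + 1, by split_ifs <;> omega⟩)
      (fun i => ?_) _).symm.trans ?_
    · simp; omega
    refine (CSubEquiv.congrRen _ (CSubEquiv.discard_subAt (n := k) g rfl (by omega) (by omega)
      (fun i => rfl) (R' := fun i => ⟨if i.val < n + m₁ then i.val else i.val + k,
        by split_ifs <;> omega⟩) (fun i => rfl) _)).trans (CSubEquiv.ren_trans (fun i => ?_) _)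
    simp; omega
  | renCons ρ rest ih =>
    simp only [PreSub.apply]
    refine (CSubEquiv.congrRen _ (CSubEquiv.substTuple_ren x ρ rest)).trans
      (.trans (CSubEquiv.ren_trans (fun i => ?_) _) (ih _))
    simp [bsum_val, idRen]

theorem CSubEquiv.normal_form {p n : ℕ} (s : PreSub V.C p n) :
    CSubEquiv V s (.renCons (Fin.castAdd p)
      (substTuple n (fun i => s.apply V.toRenPreoperad (V.proj i)) .nil)) := by
  refine .trans (.symm ?_) (CSubEquiv.castAdd_substTuple V.proj s)
  refine (CSubEquiv.congrRen _ (CSubEquiv.substTuple_proj (fun i => i) (R := fun i =>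
      ⟨if i.val < n then i.val else i.val - n, by split_ifs <;> omega⟩)
    (fun i => ?_) s)).trans ((CSubEquiv.ren_trans (r := idRen n) (fun i => ?_) _).trans (.unit₂ s))
  · simp
  · simp [idRen]

/-- Two words are identified as soon as they act in the same way on projections. -/
theorem CSubEquiv.of_apply_proj {p n : ℕ} {s t : PreSub V.C p n}
    (h : ∀ i, s.apply V.toRenPreoperad (V.proj i) = t.apply V.toRenPreoperad (V.proj i)) :
    CSubEquiv V s t := by
  refine (CSubEquiv.normal_form s).trans ?_
  rw [funext h]
  exact (CSubEquiv.normal_form t).symm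

end Completeness

section Whiskering

variable {V : CartOperad}

open PreSub

theorem CartOperad.ren_ren (V : CartOperad) {a b c : ℕ} (f : V.C a) (r₁ : Ren a b)
    (r₂ : Ren b c) : V.ren (V.ren f r₁) r₂ = V.ren f (fun i => r₂ (r₁ i)) :=
  (V.ren_comp f r₁ r₂).symm

theorem CartOperad.ren_congr (V : CartOperad) {a b : ℕ} (f : V.C a) {r r' : Ren a b}
    (h : ∀ i, (r i).val = (r' i).val) : V.ren f r = V.ren f r' := by
  rw [funext fun i => Fin.ext (h i)]

theorem CartOperad.ren_self (V : CartOperad) {a : ℕ} (f : V.C a) {r : Ren a a}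
    (h : ∀ i, (r i).val = i.val) : V.ren f r = f :=
  (V.ren_congr f h).trans (V.ren_id f)

/-- Substitution for a variable that does not occur. -/
theorem CartOperad.subst_ren_of_ne (V : CartOperad) {a m₁ m₂ k : ℕ} (f : V.C a) (g : V.C k)
    {r : Ren a (m₁ + 1 + m₂)} {r' : Ren a (m₁ + k + m₂)} (h : ∀ i, (r i).val ≠ m₁)
    (h' : ∀ i, (r' i).val = if (r i).val < m₁ then (r i).val else (r i).val - 1 + k) :
    V.subst m₁ m₂ (V.ren f r) g = V.ren f r' := by
  have := V.discard_nat (m₁ := m₁) (m₂ := m₂) (V.ren f fun i =>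
    (⟨if (r i).val < m₁ then (r i).val else (r i).val - 1, by
      have := h i; have := (r i).isLt; split_ifs <;> omega⟩ : Fin (m₁ + 0 + m₂))) g
  rw [V.ren_ren, V.ren_ren] at this
  refine Eq.trans ?_ (this.trans (V.ren_congr f fun i => ?_))
  · congr 1
    refine V.ren_congr f fun i => ?_
    have := h i
    simp only [bsum_val, idRen]
    split_ifs <;> omega
  · have := h i
    simp only [bsum_val, idRen, h']
    split_ifs <;> omega

theorem CartOperad.subst_ren_bsum (V : CartOperad) {n₁ n₂ m₁ m₂ k : ℕ}
    (f : V.C (n₁ + 1 + n₂)) (g : V.C k) (r₁ : Ren n₁ m₁) (r₂ : Ren n₂ m₂) :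
    V.subst m₁ m₂ (V.ren f (bsum (bsum r₁ (idRen 1)) r₂)) g =
      V.ren (V.subst n₁ n₂ f g) (bsum (bsum r₁ (idRen k)) r₂) := by
  rw [V.ren_subst, V.ren_id]

theorem PreSub.apply_append (P : RenPreoperad) {m k n : ℕ} (s : PreSub P.C k n)
    (t : PreSub P.C m k) (f : P.C n) : (s.append t).apply P f = t.apply P (s.apply P f) := by
  induction s with
  | nil => simp only [append, apply]
  | subCons m₁ m₂ g rest ih => simp only [append, apply, ih]
  | renCons r rest ih => simp only [append, apply, ih]

theorem PreSub.apply_whiskL_castAdd {l m n : ℕ} (s : PreSub V.C m n) (f : V.C l) :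
    (s.whiskL l).apply V.toRenPreoperad (V.ren f (Fin.castAdd n)) =
      V.ren f (Fin.castAdd m) := by
  induction s with
  | nil => simp only [whiskL, apply]
  | @subCons m₁ m₂ k g rest ih =>
    simp only [whiskL, apply, apply_castU, acast_eq_ren]
    rw [V.ren_ren, V.subst_ren_of_ne (r' := fun i => ⟨i.val, by omega⟩), V.ren_ren, ← ih]
    · rfl
    · intro i; simp; omega
    · intro i; simp; omega
  | renCons r rest ih =>
    simp only [whiskL, apply]
    rw [V.ren_ren, ← ih]
    congr 1
    exact V.ren_congr f fun i => by simp [bsum_val, idRen]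

theorem PreSub.apply_whiskL_natAdd {l m n : ℕ} (s : PreSub V.C m n) (f : V.C n) :
    (s.whiskL l).apply V.toRenPreoperad (V.ren f (Fin.natAdd l)) =
      V.ren (s.apply V.toRenPreoperad f) (Fin.natAdd l) := by
  induction s with
  | nil => simp only [whiskL, apply]
  | @subCons m₁ m₂ k g rest ih =>
    simp only [whiskL, apply, apply_castU, acast_eq_ren]
    rw [V.ren_ren, ← ih]
    have := V.subst_ren_bsum f g (Fin.natAdd l) (idRen m₂)
    rw [V.ren_congr f (r' := fun i => Fin.cast (by omega) (Fin.natAdd l i))] at this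
    · rw [this, V.ren_ren]
      congr 1
      refine V.ren_congr _ fun i => ?_
      simp [bsum_val, idRen]; split_ifs <;> (try simp) <;> omega
    · intro i
      simp [bsum_val, idRen]; split_ifs <;> (try simp) <;> omega
  | renCons r rest ih =>
    simp only [whiskL, apply]
    rw [V.ren_ren, ← ih, V.ren_ren]
    congr 1
    exact V.ren_congr f fun i => by simp [bsum_val]

theorem PreSub.apply_whiskR_castAdd {l m n : ℕ} (s : PreSub V.C m n) (f : V.C n) :
    (s.whiskR l).apply V.toRenPreoperad (V.ren f (Fin.castAdd l)) =
      V.ren (s.apply V.toRenPreoperad f) (Fin.castAdd l) := by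
  induction s with
  | nil => simp only [whiskR, apply]
  | @subCons m₁ m₂ k g rest ih =>
    simp only [whiskR, apply, apply_castU, acast_eq_ren]
    rw [V.ren_ren, ← ih]
    have := V.subst_ren_bsum f g (idRen m₁) (Fin.castAdd l)
    rw [V.ren_congr f (r' := fun i => Fin.cast (by omega) (Fin.castAdd l i))] at this
    · rw [this, V.ren_ren]
      congr 1
      refine V.ren_congr _ fun i => ?_
      simp [bsum_val, idRen]; split_ifs <;> (try simp) <;> omega
    · intro i
      simp [bsum_val, idRen]; split_ifs <;> (try simp) <;> omega
  | renCons r rest ih =>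
    simp only [whiskR, apply]
    rw [V.ren_ren, ← ih, V.ren_ren]
    congr 1
    exact V.ren_congr f fun i => by simp [bsum_val]

theorem PreSub.apply_whiskR_natAdd {l m n : ℕ} (s : PreSub V.C m n) (f : V.C l) :
    (s.whiskR l).apply V.toRenPreoperad (V.ren f (Fin.natAdd n)) =
      V.ren f (Fin.natAdd m) := by
  induction s with
  | nil => simp only [whiskR, apply]
  | @subCons m₁ m₂ k g rest ih =>
    simp only [whiskR, apply, apply_castU, acast_eq_ren]
    rw [V.ren_ren, V.subst_ren_of_ne (r' := fun i => ⟨m₁ + k + m₂ + i.val, by omega⟩),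
      V.ren_ren, ← ih]
    · rfl
    · intro i; simp; omega
    · intro i; simp; split_ifs <;> omega
  | renCons r rest ih =>
    simp only [whiskR, apply]
    rw [V.ren_ren, ← ih]
    congr 1
    exact V.ren_congr f fun i => by simp [bsum_val, idRen]

end Whiskering

namespace CSUBQ

variable {V : CartOperad}

open PreSub

/-- The action of a morphism of `CSUB[V]` on elements of `V`. -/
def act {m n : ℕ} (q : CSUBQ V m n) (f : V.C n) : V.C m :=
  Quot.lift (fun s => PreSub.apply V.toRenPreoperad s f) (fun _ _ h => h.apply_eq f) q

theorem ext {m n : ℕ} {q q' : CSUBQ V m n}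
    (h : ∀ i, act q (V.ren V.one fun _ => i) = act q' (V.ren V.one fun _ => i)) : q = q' := by
  induction q using Quot.ind
  induction q' using Quot.ind
  exact Quot.sound (.of_apply_proj h)

/-- The class of a singleton renaming word. -/
def ofRen {a b : ℕ} (r : Ren a b) : CSUBQ V b a := Quot.mk _ (.renCons r .nil)

/-- Composition in `CSUB[V]`, given by concatenation. -/
def comp {a b c : ℕ} : CSUBQ V a b → CSUBQ V b c → CSUBQ V a c :=
  Quot.map₂ (fun t s => s.append t)
    (fun t s s' h => .of_apply_proj fun i => by
      simp only [apply_append, h.apply_eq])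
    (fun t t' s h => .of_apply_proj fun i => by
      simp only [apply_append, h.apply_eq])

/-- Left whiskering in `CSUB[V]`. -/
def whiskL (k : ℕ) {m n : ℕ} : CSUBQ V m n → CSUBQ V (k + m) (k + n) :=
  Quot.map (PreSub.whiskL k) fun s t h => .of_apply_proj fun i => by
    refine Fin.addCases (fun j => ?_) (fun j => ?_) i
    · rw [← V.ren_proj, apply_whiskL_castAdd, apply_whiskL_castAdd]
    · rw [← V.ren_proj, apply_whiskL_natAdd, apply_whiskL_natAdd, h.apply_eq]

/-- Right whiskering in `CSUB[V]`. -/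
def whiskR (k : ℕ) {m n : ℕ} : CSUBQ V m n → CSUBQ V (m + k) (n + k) :=
  Quot.map (PreSub.whiskR k) fun s t h => .of_apply_proj fun i => by
    refine Fin.addCases (fun j => ?_) (fun j => ?_) i
    · rw [← V.ren_proj, apply_whiskR_castAdd, apply_whiskR_castAdd, h.apply_eq]
    · rw [← V.ren_proj, apply_whiskR_natAdd, apply_whiskR_natAdd]

theorem act_nil {n : ℕ} (f : V.C n) : act (Quot.mk _ .nil) f = f := by
  simp only [act, PreSub.apply]

theorem act_ofRen {a b : ℕ} (r : Ren a b) (f : V.C a) : act (ofRen r) f = V.ren f r := by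
  simp only [act, ofRen, PreSub.apply]

theorem act_comp {a b c : ℕ} (t : CSUBQ V a b) (s : CSUBQ V b c) (f : V.C c) :
    act (comp t s) f = act t (act s f) := by
  induction t using Quot.ind
  induction s using Quot.ind
  exact apply_append _ _ _ _

theorem act_hcast {a a' b b' : ℕ} (h₁ : a = a') (h₂ : b = b') (q : CSUBQ V a b) (f : V.C b') :
    act (hcast (H := CSUBQ V) h₁ h₂ q) f =
      V.ren (act q (V.ren f (Fin.cast h₂.symm))) (Fin.cast h₁) := by
  subst h₁ h₂
  rw [V.ren_self f (r := Fin.cast _) fun i => rfl, V.ren_self _ (r := Fin.cast _) fun i => rfl]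
  rfl

theorem act_whiskL_of_lt {k m n a : ℕ} (q : CSUBQ V m n) (f : V.C a) {r : Ren a (k + n)}
    (h : ∀ i, (r i).val < k) :
    act (whiskL k q) (V.ren f r) = V.ren f fun i => ⟨(r i).val, by have := h i; omega⟩ := by
  induction q using Quot.ind with | mk s
  have := apply_whiskL_castAdd s (V.ren f fun i => (⟨(r i).val, h i⟩ : Fin k))
  rw [V.ren_ren, V.ren_ren] at this
  exact this

theorem act_whiskL_of_ge {k m n a : ℕ} (q : CSUBQ V m n) (f : V.C a) {r : Ren a (k + n)}
    (h : ∀ i, k ≤ (r i).val) :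
    act (whiskL k q) (V.ren f r) = V.ren (act q (V.ren f fun i => ⟨(r i).val - k, by
      have := h i; omega⟩)) (Fin.natAdd k) := by
  induction q using Quot.ind with | mk s
  refine Eq.trans ?_ (apply_whiskL_natAdd s _)
  rw [V.ren_ren]
  exact congrArg _ (V.ren_congr f fun i => by have := h i; simp; omega)

theorem act_whiskR_of_lt {k m n a : ℕ} (q : CSUBQ V m n) (f : V.C a) {r : Ren a (n + k)}
    (h : ∀ i, (r i).val < n) :
    act (whiskR k q) (V.ren f r) = V.ren (act q (V.ren f fun i => ⟨(r i).val, h i⟩))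
      (Fin.castAdd k) := by
  induction q using Quot.ind with | mk s
  refine Eq.trans ?_ (apply_whiskR_castAdd s _)
  rw [V.ren_ren]
  exact congrArg _ (V.ren_congr f fun i => rfl)

theorem act_whiskR_of_ge {k m n a : ℕ} (q : CSUBQ V m n) (f : V.C a) {r : Ren a (n + k)}
    (h : ∀ i, n ≤ (r i).val) :
    act (whiskR k q) (V.ren f r) = V.ren f fun i => ⟨m + ((r i).val - n), by
      have := (r i).isLt; have := h i; omega⟩ := by
  induction q using Quot.ind with | mk s
  have := apply_whiskR_natAdd s (V.ren f fun i => (⟨(r i).val - n, by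
    have := (r i).isLt; have := h i; omega⟩ : Fin k))
  rw [V.ren_ren, V.ren_ren] at this
  refine Eq.trans (congrArg _ (V.ren_congr f fun i => ?_)) this
  have := h i; simp; omega

theorem act_whiskL_natAdd {k m n : ℕ} (q : CSUBQ V m n) (f : V.C n) :
    act (whiskL k q) (V.ren f (Fin.natAdd k)) = V.ren (act q f) (Fin.natAdd k) := by
  induction q using Quot.ind
  exact apply_whiskL_natAdd _ f

theorem act_whiskR_castAdd {k m n : ℕ} (q : CSUBQ V m n) (f : V.C n) :
    act (whiskR k q) (V.ren f (Fin.castAdd k)) = V.ren (act q f) (Fin.castAdd k) := by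
  induction q using Quot.ind
  exact apply_whiskR_castAdd _ f

theorem ren_act_congr {m n a b : ℕ} (q : CSUBQ V m n) (f : V.C a) {r r' : Ren a n}
    {ρ ρ' : Ren m b} (h : ∀ i, (r i).val = (r' i).val) (h' : ∀ i, (ρ i).val = (ρ' i).val) :
    V.ren (act q (V.ren f r)) ρ = V.ren (act q (V.ren f r')) ρ' := by
  rw [V.ren_congr f h, V.ren_congr _ h']

theorem ren_act_of_self {m n a : ℕ} (q : CSUBQ V m n) (f : V.C a) {r r' : Ren a n}
    {ρ : Ren m m} (h : ∀ i, (r i).val = (r' i).val) (h' : ∀ i, (ρ i).val = i.val) :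
    V.ren (act q (V.ren f r)) ρ = act q (V.ren f r') := by
  rw [V.ren_congr f h, V.ren_self _ h']

/-- The pre-PROP structure of the cartesian substitution construction. -/
def prePROP (V : CartOperad) : PrePROPOn (CSUBQ V) where
  id n := Quot.mk _ .nil
  comp := comp
  comp_id f := ext fun i => by rw [act_comp, act_nil]
  id_comp f := ext fun i => by rw [act_comp, act_nil]
  comp_assoc f g h := ext fun i => by simp only [act_comp]
  whiskL := whiskL
  whiskR := whiskR
  whiskL_id k n := congrArg (Quot.mk _) (by simp only [PreSub.whiskL])
  whiskR_id k n := congrArg (Quot.mk _) (by simp only [PreSub.whiskR])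
  whiskL_comp k a b c f g := ext fun i => by
    rw [act_comp]
    by_cases hi : i.val < k
    · rw [act_whiskL_of_lt _ _ fun _ => hi, act_whiskL_of_lt _ _ fun _ => hi]
      exact (act_whiskL_of_lt f V.one (r := fun _ => ⟨i.val, by omega⟩) fun _ => hi).symm
    · rw [act_whiskL_of_ge _ _ fun _ => Nat.le_of_not_lt hi,
        act_whiskL_of_ge _ _ fun _ => Nat.le_of_not_lt hi, act_comp, act_whiskL_natAdd]
  whiskR_comp k a b c f g := ext fun i => by
    rw [act_comp]
    by_cases hi : i.val < c
    · rw [act_whiskR_of_lt _ _ fun _ => hi, act_whiskR_of_lt _ _ fun _ => hi, act_comp,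
        act_whiskR_castAdd]
    · rw [act_whiskR_of_ge _ _ fun _ => Nat.le_of_not_lt hi,
        act_whiskR_of_ge _ _ fun _ => Nat.le_of_not_lt hi, act_whiskR_of_ge _ _ fun _ => by simp]
      exact V.ren_congr _ fun _ => by simp
  whiskL_zero f := ext fun i => by
    rw [act_hcast, act_whiskL_of_ge _ _ (by simp), V.ren_ren]
    exact ren_act_congr _ _ (fun _ => by simp) (fun _ => by simp)
  whiskR_zero f := ext fun i => by
    rw [act_whiskR_of_lt _ _ (fun _ => i.isLt)]
    exact ren_act_of_self _ _ (fun _ => by simp) (fun _ => by simp)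
  whiskL_add k l m n f := ext fun i => by
    rw [act_hcast, V.ren_ren]
    by_cases hi : i.val < k
    · rw [act_whiskL_of_lt _ _ fun _ => hi, act_whiskL_of_lt _ _ fun _ => by simp; omega, V.ren_ren]
      exact V.ren_congr _ fun _ => by simp
    · rw [act_whiskL_of_ge _ _ fun _ => Nat.le_of_not_lt hi]
      by_cases hi' : i.val < k + l
      · rw [act_whiskL_of_lt _ _ fun _ => by simp; omega,
          act_whiskL_of_lt _ _ fun _ => by simp; omega, V.ren_ren, V.ren_ren]
        exact V.ren_congr _ fun _ => by simp; omega
      · rw [act_whiskL_of_ge _ _ fun _ => by simp; omega,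
          act_whiskL_of_ge _ _ fun _ => by simp; omega, V.ren_ren, V.ren_ren]
        exact ren_act_congr _ _ (fun _ => by simp; omega) (fun _ => by simp; omega)
  whiskR_add k l m n f := ext fun i => by
    rw [act_hcast, V.ren_ren]
    by_cases hi : i.val < n
    · rw [act_whiskR_of_lt _ _ fun _ => Nat.lt_add_right k hi,
        act_whiskR_of_lt _ _ fun _ => hi, act_whiskR_of_lt _ _ fun _ => hi, V.ren_ren, V.ren_ren]
      exact ren_act_congr _ _ (fun _ => by simp) (fun _ => by simp)
    · rw [act_whiskR_of_ge (k := k + l) _ _ fun _ => by simp; omega]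
      by_cases hi' : i.val < n + k
      · rw [act_whiskR_of_lt _ _ fun _ => hi', act_whiskR_of_ge _ _ fun _ => Nat.le_of_not_lt hi,
          V.ren_ren, V.ren_ren]
        exact V.ren_congr _ fun _ => by simp
      · rw [act_whiskR_of_ge _ _ fun _ => Nat.le_of_not_lt hi', V.ren_ren]
        exact V.ren_congr _ fun _ => by simp; omega
  whisk_exch k l m n f := ext fun i => by
    rw [act_hcast, V.ren_ren]
    by_cases hi : i.val < k
    · rw [act_whiskL_of_lt _ _ fun _ => hi, act_whiskR_of_lt _ _ fun _ => by simp; omega,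
        act_whiskL_of_lt _ _ fun _ => by simpa using hi, V.ren_ren, V.ren_ren]
      exact V.ren_congr _ fun _ => by simp
    · rw [act_whiskL_of_ge _ _ fun _ => Nat.le_of_not_lt hi]
      by_cases hi' : i.val < k + n
      · rw [act_whiskR_of_lt _ _ fun _ => by simp; omega,
          act_whiskR_of_lt _ _ fun _ => by simp; omega,
          act_whiskL_of_ge _ _ fun _ => by simp; omega, V.ren_ren, V.ren_ren, V.ren_ren]
        exact ren_act_congr _ _ (fun _ => by simp) (fun _ => by simp)
      · rw [act_whiskR_of_ge _ _ fun _ => by simp; omega,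
          act_whiskR_of_ge _ _ fun _ => by simp; omega,
          V.ren_ren, V.ren_ren]
        exact V.ren_congr _ fun _ => by simp; omega
  sym m n := ofRen (swapRen n m)
  sym_sym m n := ext fun i => by
    rw [act_comp, act_ofRen, act_ofRen, V.ren_ren, V.ren_ren, act_nil]
    exact V.ren_congr _ fun _ => by simp only [swapRen_val]; split_ifs <;> omega
  sym_natL k f := ext fun i => by
    rw [act_comp, act_comp, act_ofRen, act_ofRen, V.ren_ren]
    by_cases hi : i.val < k
    · rw [act_whiskL_of_lt _ _ fun _ => hi,
        act_whiskR_of_ge _ _ fun _ => by simp [swapRen_val, hi], V.ren_ren]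
      exact V.ren_congr _ fun _ => by simp [swapRen_val, hi]
    · rw [act_whiskL_of_ge _ _ fun _ => Nat.le_of_not_lt hi,
        act_whiskR_of_lt _ _ fun _ => by simp [swapRen_val, hi]; omega, V.ren_ren]
      exact ren_act_congr _ _ (fun _ => by simp [swapRen_val, hi]) (fun _ => by simp [swapRen_val])
  sym_natR {m n} k f := ext fun i => by
    rw [act_comp, act_comp, act_ofRen, act_ofRen, V.ren_ren]
    by_cases hi : i.val < n
    · rw [act_whiskR_of_lt _ _ fun _ => hi,
        act_whiskL_of_ge _ _ fun _ => by simp [swapRen_val, hi], V.ren_ren]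
      exact ren_act_congr _ _ (fun _ => by simp [swapRen_val, hi]) (fun _ => by simp [swapRen_val])
    · rw [act_whiskR_of_ge _ _ fun _ => Nat.le_of_not_lt hi,
        act_whiskL_of_lt _ _ fun _ => by simp [swapRen_val, hi]; omega, V.ren_ren]
      exact V.ren_congr _ fun _ => by simp [swapRen_val, hi]
  sym_add m n k := ext fun i => by
    rw [act_hcast, V.ren_ren, act_comp, act_ofRen, V.ren_ren]
    by_cases hi : i.val < k + m
    · rw [act_whiskR_of_lt _ _ fun _ => by simpa using hi, act_ofRen, act_hcast]
      simp only [V.ren_ren]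
      by_cases hi' : i.val < k
      · rw [act_whiskL_of_ge _ _ fun _ => by simp [swapRen_val, hi'], act_ofRen]
        simp only [V.ren_ren]
        exact V.ren_congr _ fun _ => by simp [swapRen_val, hi']; omega
      · rw [act_whiskL_of_lt _ _ fun _ => by simp [swapRen_val, hi']; omega]
        simp only [V.ren_ren]
        exact V.ren_congr _ fun _ => by simp [swapRen_val, hi']
    · rw [act_whiskR_of_ge _ _ fun _ => by simp; omega, act_hcast]
      simp only [V.ren_ren]
      rw [act_whiskL_of_ge _ _ fun _ => by simp; omega, act_ofRen]
      simp only [V.ren_ren]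
      exact V.ren_congr _ fun _ => by simp [swapRen_val]; split_ifs <;> omega

end CSUBQ

namespace CSUBQ

variable {V : CartOperad}

theorem act_whiskL_ofRen {k a b : ℕ} (r : Ren a b) (f : V.C (k + a)) :
    act (whiskL k (ofRen r)) f = V.ren f (bsum (idRen k) r) := by
  rw [← act_ofRen]
  congr 1
  exact congrArg (Quot.mk _) (by simp only [PreSub.whiskL])

theorem act_whiskR_ofRen {k a b : ℕ} (r : Ren a b) (f : V.C (a + k)) :
    act (whiskR k (ofRen r)) f = V.ren f (bsum r (idRen k)) := by
  rw [← act_ofRen]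
  congr 1
  exact congrArg (Quot.mk _) (by simp only [PreSub.whiskR])

theorem whiskL_whiskR_ofRen {k l a b : ℕ} (r : Ren a b) :
    whiskL k (whiskR l (ofRen r)) =
      (ofRen (bsum (idRen k) (bsum r (idRen l))) : CSUBQ V _ _) :=
  congrArg (Quot.mk _) (by simp only [PreSub.whiskR, PreSub.whiskL])

theorem interchange {m n m' n' : ℕ} (f : CSUBQ V m n) (g : CSUBQ V m' n') :
    comp (whiskR m' f) (whiskL n g) = comp (whiskL m g) (whiskR n' f) := ext fun i => by
  rw [act_comp, act_comp]
  by_cases hi : i.val < n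
  · have hg := act_whiskL_of_lt (k := m) g (act f (V.ren V.one fun _ => ⟨i.val, hi⟩))
      (r := Fin.castAdd n') fun j => j.isLt
    have hf := act_whiskR_of_lt (k := m') f V.one (r := fun _ => ⟨i.val, by omega⟩) fun _ => hi
    rw [act_whiskL_of_lt _ _ fun _ => hi, hf, act_whiskR_of_lt _ _ fun _ => hi, hg]
    rfl
  · have hi' := Nat.le_of_not_lt hi
    have hf := act_whiskR_of_ge f (act g (V.ren V.one fun _ => ⟨i.val - n, by omega⟩))
      (r := Fin.natAdd n) fun j => by simp
    have hg := act_whiskL_of_ge (k := m) g V.one (r := fun _ => ⟨m + (i.val - n), by omega⟩)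
      fun _ => by simp
    rw [act_whiskL_of_ge _ _ fun _ => hi', act_whiskR_of_ge _ _ fun _ => hi', hf, hg]
    simp only [Nat.add_sub_cancel_left]
    exact V.ren_congr _ fun _ => by simp

/-- The cartesian PROP structure of the cartesian substitution construction. -/
def cartPROP (V : CartOperad) : CartPROPOn (CSUBQ V) where
  toPrePROPOn := prePROP V
  allCentral f _ _ g := ⟨interchange f g, (interchange g f).symm⟩
  copy n := ofRen (copyRen n)
  discard n := ofRen (discardRen n)
  copy_counitL n := ext fun i => by
    dsimp only [prePROP, PrePROPOn.tens]
    rw [act_comp, act_whiskR_ofRen, act_ofRen, act_hcast, act_nil]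
    simp only [V.ren_ren]
    exact V.ren_congr _ fun _ => by simp [copyRen_val, bsum_val, idRen]
  copy_counitR n := ext fun i => by
    dsimp only [prePROP, PrePROPOn.tens]
    rw [act_comp, act_whiskL_ofRen, act_ofRen, act_nil]
    simp only [V.ren_ren]
    exact V.ren_congr _ fun _ => by simp [copyRen_val, bsum_val, idRen]
  copy_coassoc n := ext fun i => by
    dsimp only [prePROP, PrePROPOn.tens]
    rw [act_hcast, act_comp, act_comp, act_whiskL_ofRen, act_whiskR_ofRen, act_ofRen, act_ofRen]
    simp only [V.ren_ren]
    exact V.ren_congr _ fun _ => by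
      simp [copyRen_val, bsum_val, idRen]; split_ifs <;> omega
  copy_comm n := ext fun i => by
    dsimp only [prePROP, PrePROPOn.tens]
    rw [act_comp, act_ofRen, act_ofRen, act_ofRen]
    simp only [V.ren_ren]
    exact V.ren_congr _ fun _ => by
      simp only [copyRen_val, swapRen_val]; split_ifs <;> omega
  copy_natural {m n} f := ext fun i => by
    dsimp only [prePROP, PrePROPOn.tens]
    rw [act_comp, act_comp, act_comp, act_ofRen, act_ofRen]
    simp only [V.ren_ren]
    by_cases hi : i.val < n
    · have hf := act_whiskR_of_lt (k := m) f V.one (r := fun _ => ⟨i.val, by omega⟩) fun _ => hi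
      rw [act_whiskL_of_lt _ _ fun _ => hi, hf, V.ren_ren]
      exact (ren_act_of_self _ _ (fun _ => by simp [copyRen_val, hi])
        fun _ => by simp [copyRen_val]).symm
    · have hf := act_whiskR_of_ge (k := m) f (act f (V.ren V.one fun _ => ⟨i.val - n, by omega⟩))
        (r := Fin.natAdd n) fun j => by simp
      rw [act_whiskL_of_ge _ _ fun _ => Nat.le_of_not_lt hi, hf, V.ren_ren]
      exact (ren_act_of_self _ _ (fun _ => by simp [copyRen_val, hi])
        fun _ => by simp [copyRen_val]).symm
  discard_natural f := ext fun i => i.elim0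
  copy_add m n := ext fun i => by
    dsimp only [prePROP, PrePROPOn.tens]
    rw [whiskL_whiskR_ofRen, act_comp, act_comp, act_hcast, act_whiskL_ofRen, act_whiskR_ofRen,
      act_ofRen, act_ofRen]
    simp only [V.ren_ren]
    exact V.ren_congr _ fun _ => by
      simp [copyRen_val, swapRen_val, bsum_val, idRen]; split_ifs <;> omega
  discard_add m n := ext fun i => i.elim0

end CSUBQ

/-- For every cartesian operad `V`, the cartesian substitution
construction `CSUB[V]` — with composition, whiskering and symmetries as in the
substitution construction, and copy and discard given by the singleton renaming words
`[Δₙ]` and `[!ₙ]` — is a cartesian PROP (in particular every morphism is central). -/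
theorem stmt4 (V : CartOperad) : ∃ S : CartPROPOn (CSUBQ V), InducedV V S :=
  ⟨CSUBQ.cartPROP V, fun _ => rfl, fun _ _ => rfl, fun _ _ _ _ => rfl, fun _ _ _ _ => rfl,
    fun _ _ => rfl, fun _ => rfl, fun _ => rfl⟩
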